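/- arXiv:2403.06781 — 10 statements merged into one kernel-verified Lean document; each statement's English description precedes it below -/
import Mathlib

section
/- For every positive integer t there exists a constant N(t) such that the following holds: if (G,+) is a finite group (not necessarily abelian) whose smallest prime divisor of |G| is larger than t, then every finite multiset M = [a_1^{λ_1}, a_2^{λ_2}, …, a_n^{λ_n}] of non-identity elements of G whose underlying set {a_1, a_2, …, a_n} has cardinality n ≥ N(t) is t-weakly sequenceable. -/
/-- A list `l = (y₁, …, y_m)` over an additive group is a `t`-weak ordering (of the
multiset of its terms) if the partial sums `s_i = (l.take i).sum` satisfy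
`s_i ≠ s_j` whenever `1 ≤ |i - j| ≤ t`. -/
def tWeakOrd {G : Type*} [AddGroup G] (t : ℕ) (l : List G) : Prop :=
  ∀ i j : ℕ, i < j → j ≤ l.length → j - i ≤ t →
    (l.take i).sum ≠ (l.take j).sum

/-- A multiset `M` is `t`-weakly sequenceable if some listing of its elements
is a `t`-weak ordering. -/
def tWeakSequenceable {G : Type*} [AddGroup G] (t : ℕ) (M : Multiset G) : Prop :=
  ∃ l : List G, (↑l : Multiset G) = M ∧ tWeakOrd t l

/-- No nonempty block of at most `t` consecutive terms of `l` sums to zero. -/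
def ZeroBlockFree {G : Type*} [AddGroup G] (t : ℕ) (l : List G) : Prop :=
  ∀ w, w <:+: l → w ≠ [] → w.length ≤ t → w.sum ≠ 0

/-- The list obtained from `σ` by repeating each entry `a` in a run of length `c a`. -/
def expandRuns {G : Type*} (c : G → ℕ) (σ : List G) : List G :=
  σ.flatMap fun a => List.replicate (c a) a

section ZeroBlockFree

variable {G : Type*} [AddGroup G] {t : ℕ}

theorem ZeroBlockFree.tWeakOrd {l : List G} (h : ZeroBlockFree t l) : tWeakOrd t l := by
  intro i j hij hj ht heq
  have hlen : ((l.take j).drop i).length = j - i := by simp [hj]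
  have hsplit : (l.take i).sum + ((l.take j).drop i).sum = (l.take j).sum := by
    rw [← List.sum_append]
    congr 1
    have := List.take_append_drop i (l.take j)
    rwa [List.take_take, min_eq_left hij.le] at this
  refine h ((l.take j).drop i)
    ((List.drop_suffix i _).isInfix.trans (List.take_prefix j l).isInfix) ?_ (by omega) ?_
  · intro hw
    rw [hw] at hlen
    simp at hlen
    omega
  · rw [← heq] at hsplit
    simpa using hsplit

theorem prefix_append_cases {α : Type*} {w l₁ l₂ : List α} (h : w <+: l₁ ++ l₂) :
    w <+: l₁ ∨ ∃ v, w = l₁ ++ v ∧ v <+: l₂ := by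
  rcases List.prefix_or_prefix_of_prefix h (List.prefix_append l₁ l₂) with h' | ⟨v, rfl⟩
  · exact Or.inl h'
  · exact Or.inr ⟨v, rfl, (List.prefix_append_right_inj l₁).1 h⟩

theorem suffix_append_cases {α : Type*} {w l₁ l₂ : List α} (h : w <:+ l₁ ++ l₂) :
    w <:+ l₂ ∨ ∃ u, w = u ++ l₂ ∧ u <:+ l₁ := by
  rcases List.suffix_or_suffix_of_suffix h (List.suffix_append l₁ l₂) with h' | ⟨u, rfl⟩
  · exact Or.inl h'
  · exact Or.inr ⟨u, rfl, List.suffix_append_self_iff.1 h⟩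

theorem infix_append_replicate_append {α : Type*} {w l₁ l₂ : List α} {a : α} {k : ℕ}
    (hk : 0 < k) (hw : w <:+: l₁ ++ (List.replicate k a ++ l₂)) :
    w <:+: l₁ ∨ w <:+: l₂ ∨ ∃ u m v, w = u ++ (List.replicate m a ++ v) ∧ 0 < m ∧
      u <:+ l₁ ∧ v <+: l₂ := by
  rcases List.infix_append_iff.1 hw with h | h | ⟨u, w', rfl, hu, hw'⟩
  · exact Or.inl h
  · rcases List.infix_append_iff.1 h with h | h | ⟨u, v, rfl, hu, hv⟩
    · obtain ⟨m, hm⟩ : ∃ m, w = List.replicate m a :=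
        ⟨w.length, List.eq_replicate_iff.2 ⟨rfl, fun b hb => List.eq_of_mem_replicate (h.subset hb)⟩⟩
      rcases Nat.eq_zero_or_pos m with rfl | hpos
      · exact Or.inl (by simp [hm])
      · exact Or.inr (Or.inr ⟨[], m, [], by simp [hm], hpos, List.nil_suffix, List.nil_prefix⟩)
    · exact Or.inr (Or.inl h)
    · obtain ⟨m, rfl⟩ : ∃ m, u = List.replicate m a :=
        ⟨u.length, List.eq_replicate_iff.2 ⟨rfl, fun b hb => List.eq_of_mem_replicate (hu.subset hb)⟩⟩
      rcases Nat.eq_zero_or_pos m with rfl | hpos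
      · exact Or.inr (Or.inl (by simpa using hv.isInfix))
      · exact Or.inr (Or.inr ⟨[], m, v, by simp, hpos, List.nil_suffix, hv⟩)
  · rcases prefix_append_cases hw' with h | ⟨v, rfl, hv⟩
    · obtain ⟨m, rfl⟩ : ∃ m, w' = List.replicate m a :=
        ⟨w'.length, List.eq_replicate_iff.2 ⟨rfl, fun b hb => List.eq_of_mem_replicate (h.subset hb)⟩⟩
      rcases Nat.eq_zero_or_pos m with rfl | hpos
      · exact Or.inl (by simpa using hu.isInfix)
      · exact Or.inr (Or.inr ⟨u, m, [], by simp, hpos, hu, List.nil_prefix⟩)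
    · exact Or.inr (Or.inr ⟨u, k, v, rfl, hk, hu, hv⟩)

/-- A run inserted between two lists creates no short zero block if none of the blocks meeting
the run sums to zero. -/
theorem ZeroBlockFree.append_replicate_append {l₁ l₂ : List G} {a : G} {k : ℕ} (hk : 0 < k)
    (h₁ : ZeroBlockFree t l₁) (h₂ : ZeroBlockFree t l₂)
    (h : ∀ u m v, u <:+ l₁ → v <+: l₂ → u.length ≤ t → v.length ≤ t → m ∈ Finset.Icc 1 t →
      u.sum + m • a + v.sum ≠ 0) :
    ZeroBlockFree t (l₁ ++ (List.replicate k a ++ l₂)) := by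
  intro w hw hne hlen
  rcases infix_append_replicate_append hk hw with hw | hw | ⟨u, m, v, rfl, hm, hu, hv⟩
  · exact h₁ w hw hne hlen
  · exact h₂ w hw hne hlen
  · simp only [List.length_append, List.length_replicate] at hlen
    have := h u m v hu hv (by omega) (by omega) (Finset.mem_Icc.2 ⟨hm, by omega⟩)
    simpa [add_assoc] using this

end ZeroBlockFree

section Expand

variable {G : Type*} (c : G → ℕ)

theorem expandRuns_append (σ τ : List G) :
    expandRuns c (σ ++ τ) = expandRuns c σ ++ expandRuns c τ := by
  simp [expandRuns]

theorem expandRuns_cons (a : G) (σ : List G) :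
    expandRuns c (a :: σ) = List.replicate (c a) a ++ expandRuns c σ := by
  simp [expandRuns]

theorem mem_of_mem_expandRuns {c : G → ℕ} {σ : List G} {x : G} (h : x ∈ expandRuns c σ) :
    x ∈ σ := by
  obtain ⟨a, ha, hx⟩ := List.mem_flatMap.1 h
  rwa [List.eq_of_mem_replicate hx]

theorem length_le_length_expandRuns {c : G → ℕ} {σ : List G} (h : ∀ a ∈ σ, 0 < c a) :
    σ.length ≤ (expandRuns c σ).length := by
  induction σ with
  | nil => simp
  | cons a σ ih =>
    have := ih fun b hb => h b (List.mem_cons_of_mem a hb)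
    have := h a List.mem_cons_self
    simp only [expandRuns_cons, List.length_cons, List.length_append, List.length_replicate]
    omega

theorem coe_expandRuns_count [DecidableEq G] (M : Multiset G) {σ : List G} (hσ : σ.Nodup)
    (hM : σ.toFinset = M.toFinset) : (↑(expandRuns M.count σ) : Multiset G) = M := by
  have key : ∀ τ : List G, (↑(expandRuns M.count τ) : Multiset G) =
      (τ.map fun a => M.count a • ({a} : Multiset G)).sum := by
    intro τ
    induction τ with
    | nil => rfl
    | cons a τ ih =>
      rw [expandRuns_cons, ← Multiset.coe_add, ih, List.map_cons, List.sum_cons,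
        Multiset.nsmul_singleton, Multiset.coe_replicate]
  rw [key, ← List.sum_toFinset _ hσ, hM, Multiset.toFinset_sum_count_nsmul_eq]

end Expand

theorem nsmul_injective_of_lt_minFac {G : Type*} [AddGroup G] [Fintype G] {t : ℕ}
    (hG : ∀ p : ℕ, p.Prime → p ∣ Fintype.card G → t < p) {m : ℕ} (hm : m ∈ Finset.Icc 1 t) :
    Function.Injective fun x : G => m • x := by
  have hcop : (Nat.card G).Coprime m := by
    rw [Nat.card_eq_fintype_card]
    refine Nat.coprime_of_dvd fun p hp hpG hpm => ?_
    have := Nat.le_of_dvd (Finset.mem_Icc.1 hm).1 hpm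
    have := hG p hp hpG
    have := (Finset.mem_Icc.1 hm).2
    omega
  exact (nsmulCoprime hcop).injective

section Choice

variable {G : Type*} [AddGroup G] [DecidableEq G] {t : ℕ}

theorem exists_add_nsmul_add_ne_zero
    (hinj : ∀ m ∈ Finset.Icc 1 t, Function.Injective fun x : G => m • x)
    (U V B : Finset G) (hB : U.card * V.card * t < B.card) :
    ∃ y ∈ B, ∀ u ∈ U, ∀ v ∈ V, ∀ m ∈ Finset.Icc 1 t, u + m • y + v ≠ 0 := by
  by_contra! hcon
  choose! u hu v hv m hm h using hcon
  have hcard : B.card ≤ ((U ×ˢ V) ×ˢ Finset.Icc 1 t).card := by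
    refine Finset.card_le_card_of_injOn (fun y => ((u y, v y), m y)) ?_ ?_
    · intro y hy
      simp only [Finset.mem_coe, Finset.mem_product]
      exact ⟨⟨hu y hy, hv y hy⟩, hm y hy⟩
    · intro x hx y hy hxy
      simp only [Prod.mk.injEq] at hxy
      obtain ⟨⟨hu', hv'⟩, hm'⟩ := hxy
      have h₁ := h x hx
      rw [← h y hy, hu', hv', hm'] at h₁
      exact hinj (m y) (hm y hy) (add_left_cancel (add_right_cancel h₁))
  simp only [Finset.card_product, Nat.card_Icc, Nat.add_sub_cancel] at hcard
  omega

/-- The sums of the suffixes of `l` of length at most `t`. -/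
def suffixSums (t : ℕ) (l : List G) : Finset G :=
  (Finset.range (t + 1)).image fun i => (l.drop (l.length - i)).sum

theorem sum_mem_suffixSums {l u : List G} (hu : u <:+ l) (hlen : u.length ≤ t) :
    u.sum ∈ suffixSums t l :=
  Finset.mem_image.2 ⟨u.length, Finset.mem_range.2 (by omega),
    by rw [← List.suffix_iff_eq_drop.1 hu]⟩

theorem card_suffixSums_le (t : ℕ) (l : List G) : (suffixSums t l).card ≤ t + 1 :=
  Finset.card_image_le.trans (by simp)

/-- Among more than `(t + 1) ^ 3` candidates there is a `y` whose run can follow `σ`, and can in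
turn be followed by the run of `s`. -/
theorem exists_zeroBlockFree_append_pair
    (hinj : ∀ m ∈ Finset.Icc 1 t, Function.Injective fun x : G => m • x)
    {c : G → ℕ} {σ : List G} (hσ : ZeroBlockFree t (expandRuns c σ)) {s : G} (hs : s ≠ 0)
    (hcs : 0 < c s) {B : Finset G} (hcB : ∀ b ∈ B, 0 < c b) (hB : (t + 1) ^ 3 < B.card) :
    ∃ y ∈ B, ZeroBlockFree t (expandRuns c (σ ++ [y])) ∧
      ZeroBlockFree t (expandRuns c (σ ++ [y, s])) := by
  have hnil : ZeroBlockFree t ([] : List G) := by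
    intro w hw hne
    exact absurd (List.infix_nil.1 hw) hne
  set V : Finset G := (Finset.range (t + 1)).image fun i => i • s
  have hVcard : V.card ≤ t + 1 := Finset.card_image_le.trans (by simp)
  have hVmem : ∀ m ≤ t, m • s ∈ V := fun m hm =>
    Finset.mem_image_of_mem _ (Finset.mem_range.2 (by omega))
  have hcard : (suffixSums t (expandRuns c σ)).card * V.card * t < B.card := by
    refine lt_of_le_of_lt ?_ hB
    calc _ ≤ (t + 1) * (t + 1) * (t + 1) :=
          Nat.mul_le_mul (Nat.mul_le_mul (card_suffixSums_le _ _) hVcard) (by omega)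
      _ = (t + 1) ^ 3 := by ring
  obtain ⟨y, hyB, hy⟩ := exists_add_nsmul_add_ne_zero hinj _ _ B hcard
  have hσy : ZeroBlockFree t (expandRuns c (σ ++ [y])) := by
    rw [expandRuns_append, expandRuns_cons]
    refine hσ.append_replicate_append (hcB y hyB) hnil ?_
    intro u m v hu hv hut _ hm
    obtain rfl := List.prefix_nil.1 hv
    have := hy _ (sum_mem_suffixSums hu hut) _ (hVmem 0 (by omega)) m hm
    simpa using this
  refine ⟨y, hyB, hσy, ?_⟩
  have hsplit : expandRuns c (σ ++ [y, s]) =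
      expandRuns c (σ ++ [y]) ++ (List.replicate (c s) s ++ []) := by
    simp [expandRuns]
  rw [hsplit]
  refine hσy.append_replicate_append hcs hnil ?_
  intro u m v hu hv hut _ hm
  obtain rfl := List.prefix_nil.1 hv
  rw [List.sum_nil, add_zero]
  have hms : m • s ≠ 0 := fun h => hs (hinj m hm (by simpa using h))
  obtain ⟨hm₁, hmt⟩ := Finset.mem_Icc.1 hm
  rw [expandRuns_append, expandRuns_cons] at hu
  rcases suffix_append_cases hu with hu | ⟨u', rfl, hu'⟩
  · obtain ⟨k, rfl⟩ : ∃ k, u = List.replicate k y :=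
      ⟨u.length, List.eq_replicate_iff.2 ⟨rfl, fun b hb => by
        have := hu.subset hb
        simp only [expandRuns, List.flatMap_nil, List.append_nil] at this
        exact List.eq_of_mem_replicate this⟩⟩
    rcases Nat.eq_zero_or_pos k with rfl | hk
    · simpa using hms
    · have := hy _ (sum_mem_suffixSums List.nil_suffix (by simp)) _ (hVmem m hmt) k
        (Finset.mem_Icc.2 ⟨hk, by simpa using hut⟩)
      simpa using this
  · simp only [expandRuns, List.flatMap_nil, List.append_nil, List.length_append,
      List.length_replicate] at hut
    have := hy _ (sum_mem_suffixSums hu' (by omega)) _ (hVmem m hmt) (c y)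
      (Finset.mem_Icc.2 ⟨hcB y hyB, by omega⟩)
    simpa [expandRuns] using this

/-- Greedy extension: all but `(t + 1) ^ 3` of the runs in `B` can be appended. -/
theorem exists_zeroBlockFree_append
    (hinj : ∀ m ∈ Finset.Icc 1 t, Function.Injective fun x : G => m • x) {c : G → ℕ}
    {B : Finset G} (hB₀ : ∀ b ∈ B, b ≠ 0) (hcB : ∀ b ∈ B, 0 < c b) {σ : List G}
    (hσ : ZeroBlockFree t (expandRuns c σ)) (k : ℕ) (hk : k ≤ B.card - (t + 1) ^ 3) :
    ∃ τ : List G, τ.Nodup ∧ τ.toFinset ⊆ B ∧ τ.length = k ∧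
      ZeroBlockFree t (expandRuns c (σ ++ τ)) := by
  induction k with
  | zero => exact ⟨[], by simp [hσ]⟩
  | succ k ih =>
    obtain ⟨τ, hnd, hsub, hlen, hfree⟩ := ih (by omega)
    have hcard : (t + 1) ^ 3 < (B \ τ.toFinset).card := by
      rw [Finset.card_sdiff_of_subset hsub, List.toFinset_card_of_nodup hnd]
      omega
    obtain ⟨s, hs⟩ := Finset.card_pos.1 (Nat.zero_lt_of_lt hcard)
    have hsB := (Finset.mem_sdiff.1 hs).1
    obtain ⟨y, hy, hfree', -⟩ := exists_zeroBlockFree_append_pair hinj hfree (hB₀ s hsB)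
      (hcB s hsB) (fun b hb => hcB b (Finset.mem_sdiff.1 hb).1) hcard
    obtain ⟨hyB, hyτ⟩ := Finset.mem_sdiff.1 hy
    refine ⟨τ ++ [y], ?_, ?_, by simp [hlen], by simpa using hfree'⟩
    · rw [List.nodup_append', List.disjoint_singleton]
      exact ⟨hnd, List.nodup_singleton y, fun h => hyτ (List.mem_toFinset.2 h)⟩
    · rw [List.toFinset_append]
      exact Finset.union_subset hsub (by simpa using hyB)

/-- The runs of `S` can be appended when separated by suitable runs taken from `R`. -/
theorem exists_zeroBlockFree_append_separated
    (hinj : ∀ m ∈ Finset.Icc 1 t, Function.Injective fun x : G => m • x) {c : G → ℕ}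
    {R : Finset G} (hcR : ∀ b ∈ R, 0 < c b) {σ : List G}
    (hσ : ZeroBlockFree t (expandRuns c σ)) (S : Finset G) (hS₀ : ∀ b ∈ S, b ≠ 0)
    (hcS : ∀ b ∈ S, 0 < c b) (hdisj : Disjoint S R) (hcard : (t + 1) ^ 3 + S.card ≤ R.card) :
    ∃ (τ : List G) (Q : Finset G), τ.Nodup ∧ Q ⊆ R ∧ Q.card = S.card ∧ τ.toFinset = S ∪ Q ∧
      ZeroBlockFree t (expandRuns c (σ ++ τ)) := by
  induction S using Finset.induction_on with
  | empty => exact ⟨[], ∅, by simp [hσ]⟩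
  | insert s S hsS ih =>
    rw [Finset.card_insert_of_notMem hsS] at hcard
    rw [Finset.disjoint_insert_left] at hdisj
    obtain ⟨τ, Q, hnd, hQR, hQ, hτ, hfree⟩ := ih (fun b hb => hS₀ b (Finset.mem_insert_of_mem hb))
      (fun b hb => hcS b (Finset.mem_insert_of_mem hb)) hdisj.2 (by omega)
    have hlt : (t + 1) ^ 3 < (R \ Q).card := by
      rw [Finset.card_sdiff_of_subset hQR]
      omega
    obtain ⟨y, hy, -, hfree'⟩ := exists_zeroBlockFree_append_pair hinj hfree
      (hS₀ s (Finset.mem_insert_self s S)) (hcS s (Finset.mem_insert_self s S))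
      (fun b hb => hcR b (Finset.mem_sdiff.1 hb).1) hlt
    obtain ⟨hyR, hyQ⟩ := Finset.mem_sdiff.1 hy
    have hmem : ∀ x, x ∈ τ ↔ x ∈ S ∨ x ∈ Q := fun x => by
      rw [← List.mem_toFinset, hτ, Finset.mem_union]
    have hyS : y ∉ S := fun h => Finset.disjoint_left.1 hdisj.2 h hyR
    have hsQ : s ∉ Q := fun h => hdisj.1 (hQR h)
    have hys : y ≠ s := fun h => hdisj.1 (h ▸ hyR)
    refine ⟨τ ++ [y, s], insert y Q, ?_, Finset.insert_subset hyR hQR, ?_, ?_,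
      by simpa using hfree'⟩
    · rw [List.nodup_append']
      refine ⟨hnd, by simpa using hys, ?_⟩
      intro x hx hx'
      rw [hmem] at hx
      simp only [List.mem_cons, List.not_mem_nil, or_false] at hx'
      rcases hx' with rfl | rfl <;> tauto
    · rw [Finset.card_insert_of_notMem hyQ, Finset.card_insert_of_notMem hsS, hQ]
    · ext x
      simp only [List.mem_toFinset, List.mem_append, hmem, List.mem_cons, List.not_mem_nil,
        or_false, Finset.mem_union, Finset.mem_insert]
      tauto

/-- A large set contains a subset of given size, all of whose orderings have no short zero
block. -/
theorem exists_subset_zeroBlockFree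
    (hinj : ∀ m ∈ Finset.Icc 1 t, Function.Injective fun x : G => m • x) {c : G → ℕ}
    {A : Finset G} (hcA : ∀ a ∈ A, 0 < c a) {C : ℕ}
    (hA : C + (C + 1) ^ t * (C + 1) ^ t * t ≤ A.card) (k : ℕ) (hk : k ≤ C) :
    ∃ R ⊆ A, R.card = k ∧
      ∀ σ : List G, σ.Nodup → σ.toFinset ⊆ R → ZeroBlockFree t (expandRuns c σ) := by
  induction k with
  | zero =>
    refine ⟨∅, by simp, by simp, ?_⟩
    intro σ _ hσ w hw hne
    rw [Finset.subset_empty, List.toFinset_eq_empty_iff] at hσ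
    subst hσ
    exact absurd (List.infix_nil.1 hw) hne
  | succ k ih =>
    obtain ⟨R, hRA, hRk, hfree⟩ := ih (by omega)
    open scoped Pointwise in
    set U : Finset G := t • (insert 0 R)
    have hUcard : U.card ≤ (C + 1) ^ t := by
      refine Finset.card_nsmul_le.trans (Nat.pow_le_pow_left ?_ t)
      have := Finset.card_insert_le (0 : G) R
      omega
    have hUmem : ∀ w : List G, (∀ x ∈ w, x ∈ R) → w.length ≤ t → w.sum ∈ U := by
      intro w hw hlen
      refine Finset.nsmul_subset_nsmul_right (Finset.mem_insert_self 0 R) hlen ?_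
      clear hlen
      induction w with
      | nil => simp
      | cons a w ihw =>
        rw [List.sum_cons, List.length_cons, succ_nsmul']
        exact Finset.add_mem_add (Finset.mem_insert_of_mem (hw a List.mem_cons_self))
          (ihw fun x hx => hw x (List.mem_cons_of_mem a hx))
    have hlt : U.card * U.card * t < (A \ R).card := by
      rw [Finset.card_sdiff_of_subset hRA]
      have := Nat.mul_le_mul_right t (Nat.mul_le_mul hUcard hUcard)
      omega
    obtain ⟨r, hr, hrU⟩ := exists_add_nsmul_add_ne_zero hinj U U _ hlt
    obtain ⟨hrA, hrR⟩ := Finset.mem_sdiff.1 hr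
    refine ⟨insert r R, Finset.insert_subset hrA hRA, by
      rw [Finset.card_insert_of_notMem hrR, hRk], ?_⟩
    intro σ hnd hσ
    by_cases hrσ : r ∈ σ
    · obtain ⟨σ₁, σ₂, rfl⟩ := List.append_of_mem hrσ
      have hnd' := List.nodup_middle.1 hnd
      rw [List.nodup_cons] at hnd'
      have hsub : ∀ x ∈ σ₁ ++ σ₂, x ∈ R := by
        intro x hx
        have hx' : x ∈ insert r R := hσ (by
          simp only [List.mem_toFinset, List.mem_append, List.mem_cons] at hx ⊢
          tauto)
        refine (Finset.mem_insert.1 hx').resolve_left ?_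
        rintro rfl
        exact hnd'.1 hx
      have hsub₁ : ∀ x ∈ σ₁, x ∈ R := fun x hx => hsub x (List.mem_append_left _ hx)
      have hsub₂ : ∀ x ∈ σ₂, x ∈ R := fun x hx => hsub x (List.mem_append_right _ hx)
      rw [expandRuns_append, expandRuns_cons]
      refine (hfree σ₁ hnd'.2.of_append_left fun x hx =>
        hsub₁ x (List.mem_toFinset.1 hx)).append_replicate_append (hcA r hrA)
        (hfree σ₂ hnd'.2.of_append_right fun x hx => hsub₂ x (List.mem_toFinset.1 hx)) ?_
      intro u m v hu hv hut hvt hm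
      exact hrU _ (hUmem u (fun x hx => hsub₁ x (mem_of_mem_expandRuns (hu.subset hx))) hut)
        _ (hUmem v (fun x hx => hsub₂ x (mem_of_mem_expandRuns (hv.subset hx))) hvt) m hm
    · refine hfree σ hnd fun x hx => (Finset.mem_insert.1 (hσ hx)).resolve_left ?_
      rintro rfl
      exact hrσ (List.mem_toFinset.1 hx)

end Choice

/-- For every positive integer `t` there is `N` such that: for any finite group `G`
whose smallest prime divisor of `|G|` is larger than `t`, every multiset of
non-identity elements of `G` whose underlying set has at least `N` elements is
`t`-weakly sequenceable. -/
theorem weak_multiset_sequenceability (t : ℕ) (ht : 0 < t) :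
    ∃ N : ℕ, ∀ (G : Type*) [AddGroup G] [Fintype G] [DecidableEq G],
      (∀ p : ℕ, p.Prime → p ∣ Fintype.card G → t < p) →
      ∀ M : Multiset G, (∀ x ∈ M, x ≠ (0 : G)) →
        N ≤ M.toFinset.card →
        tWeakSequenceable t M := by
  set K := (t + 1) ^ 3
  set C := K + K + t
  refine ⟨C + (C + 1) ^ t * (C + 1) ^ t * t, ?_⟩
  intro G _ _ _ hG M hM₀ hM
  have hinj : ∀ m ∈ Finset.Icc 1 t, Function.Injective fun x : G => m • x :=
    fun m hm => nsmul_injective_of_lt_minFac hG hm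
  have hc : ∀ a ∈ M.toFinset, 0 < M.count a :=
    fun a ha => Multiset.count_pos.2 (Multiset.mem_toFinset.1 ha)
  have h₀ : ∀ a ∈ M.toFinset, a ≠ 0 := fun a ha => hM₀ a (Multiset.mem_toFinset.1 ha)
  obtain ⟨R, hRM, hRC, hR⟩ := exists_subset_zeroBlockFree hinj hc hM C le_rfl
  set A := M.toFinset \ R
  have hAM : A ⊆ M.toFinset := Finset.sdiff_subset
  obtain ⟨σ, hσnd, hσA, hσlen, hσ⟩ := exists_zeroBlockFree_append (σ := []) hinj
    (fun b hb => h₀ b (hAM hb)) (fun b hb => hc b (hAM hb))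
    (hR [] List.nodup_nil (by simp)) (A.card - K) le_rfl
  rw [List.nil_append] at hσ
  have hS : (A \ σ.toFinset).card ≤ K := by
    rw [Finset.card_sdiff_of_subset hσA, List.toFinset_card_of_nodup hσnd]
    omega
  have hSA : A \ σ.toFinset ⊆ A := Finset.sdiff_subset
  have hAR : Disjoint A R := Finset.sdiff_disjoint
  obtain ⟨τ, Q, hτnd, hQR, hQ, hτ, hστ⟩ := exists_zeroBlockFree_append_separated hinj
    (fun b hb => hc b (hRM hb)) hσ (A \ σ.toFinset) (fun b hb => h₀ b (hAM (hSA hb)))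
    (fun b hb => hc b (hAM (hSA hb))) (Finset.disjoint_of_subset_left hSA hAR) (by omega)
  have hRQ : R \ Q ⊆ M.toFinset := Finset.sdiff_subset.trans hRM
  obtain ⟨ρ, hρnd, hρR, hρlen, hρ⟩ := exists_zeroBlockFree_append hinj
    (fun b hb => h₀ b (hRQ hb)) (fun b hb => hc b (hRQ hb)) hστ t (by
      rw [Finset.card_sdiff_of_subset hQR]
      omega)
  set π := ((R \ Q) \ ρ.toFinset).toList with hπ
  have hπmem : ∀ x, x ∈ π ↔ (x ∈ R ∧ x ∉ Q) ∧ x ∉ ρ := fun x => by simp [hπ]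
  have hρmem : ∀ x ∈ ρ, x ∈ R ∧ x ∉ Q := fun x hx =>
    Finset.mem_sdiff.1 (hρR (List.mem_toFinset.2 hx))
  have hσmem : ∀ x ∈ σ, x ∈ A := fun x hx => hσA (List.mem_toFinset.2 hx)
  have hτmem : ∀ x, x ∈ τ ↔ (x ∈ A ∧ x ∉ σ) ∨ x ∈ Q := fun x => by
    rw [← List.mem_toFinset, hτ]
    simp
  have hAmem : ∀ x, x ∈ A ↔ x ∈ M.toFinset ∧ x ∉ R := fun x => Finset.mem_sdiff
  have hρπ : (ρ ++ π).Nodup := by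
    refine List.nodup_append'.2 ⟨hρnd, Finset.nodup_toList _, fun x hx hx' => ?_⟩
    exact ((hπmem x).1 hx').2 hx
  have hnd : (σ ++ τ ++ ρ ++ π).Nodup := by
    rw [List.append_assoc]
    refine List.nodup_append'.2 ⟨List.nodup_append'.2 ⟨hσnd, hτnd, fun x hx hx' => ?_⟩, hρπ,
      fun x hx hx' => ?_⟩
    · have h₁ := (hAmem x).1 (hσmem x hx)
      rcases (hτmem x).1 hx' with h | h
      · exact h.2 hx
      · exact h₁.2 (hQR h)
    · have h₁ : x ∈ R ∧ x ∉ Q := (List.mem_append.1 hx').elim (hρmem x) fun h => ((hπmem x).1 h).1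
      rcases List.mem_append.1 hx with h | h
      · exact ((hAmem x).1 (hσmem x h)).2 h₁.1
      · rcases (hτmem x).1 h with h | h
        · exact ((hAmem x).1 h.1).2 h₁.1
        · exact h₁.2 h
  refine ⟨expandRuns M.count (σ ++ τ ++ ρ ++ π), coe_expandRuns_count M hnd ?_, ?_⟩
  · ext x
    simp only [List.mem_toFinset, List.mem_append]
    constructor
    · rintro (((h | h) | h) | h)
      · exact hAM (hσmem x h)
      · exact ((hτmem x).1 h).elim (fun h => hAM h.1) fun h => hRM (hQR h)
      · exact hRM (hρmem x h).1
      · exact hRM ((hπmem x).1 h).1.1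
    · intro hx
      have := hAmem x
      have := hτmem x
      have := hπmem x
      tauto
  · apply ZeroBlockFree.tWeakOrd
    have hfree : ZeroBlockFree t (expandRuns M.count (ρ ++ π)) := by
      refine hR _ hρπ fun x hx => ?_
      exact (List.mem_append.1 (List.mem_toFinset.1 hx)).elim (fun h => (hρmem x h).1)
        fun h => ((hπmem x).1 h).1.1
    have hlen : t ≤ (expandRuns M.count ρ).length :=
      hρlen ▸ length_le_length_expandRuns fun a ha => hc a (hRM (hρmem a ha).1)
    rw [expandRuns_append] at hfree
    intro w hw hne hwt
    rw [expandRuns_append] at hw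
    rcases List.infix_append_iff.1 hw with hw | hw | ⟨u, v, rfl, hu, hv⟩
    · exact hρ w hw hne hwt
    · exact hfree w (hw.trans (List.suffix_append _ _).isInfix) hne hwt
    · refine hfree _ ?_ hne hwt
      rw [expandRuns_append] at hu
      have hu' : u <:+ expandRuns M.count ρ := by
        refine List.suffix_of_suffix_length_le hu (List.suffix_append _ _) ?_
        simp only [List.length_append] at hwt
        omega
      exact List.infix_append_iff.2 (Or.inr (Or.inr ⟨u, v, rfl, hu', hv⟩))
end

section
/- For every positive integer t there exists a constant N(t) such that the following holds: if (G,+) is a finite group (not necessarily abelian) whose smallest prime divisor of |G| is larger than t(2t+1), then every finite multiset M = [a_1^{λ_1}, …, a_n^{λ_n}] of non-identity elements of G with |M| = λ_1 + λ_2 + ⋯ + λ_n ≥ N(t) admits a realization W = (w_0, w_1, …, w_{|M|}) such that w_i ≠ w_j whenever 1 ≤ |i−j| ≤ t. -/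
/-- `w : ℕ → G` (viewed as the walk `(w 0, w 1, …, w (Multiset.card M))`) is a
realization of the multiset `M` if `w 0 = 0` and there are signs
`ε₁, …, ε_ℓ ∈ {+1, -1}` such that the multiset
`[ε₁ • (-w₀ + w₁), …, ε_ℓ • (-w_{ℓ-1} + w_ℓ)]` equals `M` (where `ℓ = Multiset.card M`). -/
def IsRealization {G : Type*} [AddGroup G] (M : Multiset G) (w : ℕ → G) : Prop :=
  w 0 = 0 ∧ ∃ ε : ℕ → ℤˣ,
    (Multiset.range (Multiset.card M)).map
      (fun i => ((ε i : ℤ) • (-(w i) + w (i + 1)))) = M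

/-- Every nonempty contiguous block of `L` of length at most `t` has nonzero sum. -/
def ShortSumsNeZero {G : Type*} [AddGroup G] (t : ℕ) (L : List G) : Prop :=
  ∀ l : List G, l <:+: L → l ≠ [] → l.length ≤ t → l.sum ≠ 0

/-- `y` is `x` or `-x`. -/
def EqUpToSign {G : Type*} [AddGroup G] (x y : G) : Prop := y = x ∨ y = -x

/-- Concatenation of both halves of all slots of a list of slots. -/
def slotsJoin {G : Type*} (S : List (List G × List G)) : List G :=
  S.flatMap fun s => s.1 ++ s.2

namespace ShortSumsNeZero

variable {G : Type*} [AddGroup G] {t : ℕ}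

lemma nil : ShortSumsNeZero t ([] : List G) := by
  intro l hl hne
  exact absurd (List.infix_nil.mp hl) hne

lemma of_infix {L L' : List G} (h : ShortSumsNeZero t L) (hL : L' <:+: L) :
    ShortSumsNeZero t L' :=
  fun l hl => h l (hl.trans hL)

lemma glue {A B C : List G} (hAB : ShortSumsNeZero t (A ++ B))
    (hBC : ShortSumsNeZero t (B ++ C)) (hB : t ≤ B.length) :
    ShortSumsNeZero t (A ++ B ++ C) := by
  intro l hl hne hlen
  rcases List.infix_append_iff.mp hl with h | h | ⟨l₁, l₂, rfl, h₁, h₂⟩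
  · exact hAB l h hne hlen
  · exact hBC l (h.trans List.infix_append_right) hne hlen
  · rw [List.length_append] at hlen
    refine hBC _ ?_ hne (by simpa using hlen)
    exact List.infix_append_iff.mpr (.inr (.inr ⟨l₁, l₂, rfl,
      List.suffix_of_suffix_length_le h₁ (List.suffix_append A B) (by omega), h₂⟩))

lemma insert {L R : List G} {y : G} (hL : ShortSumsNeZero t L) (hR : ShortSumsNeZero t R)
    (hy : ∀ s p : List G, s <:+ L → p <+: R → s.length + p.length < t →
      s.sum + y + p.sum ≠ 0) :
    ShortSumsNeZero t (L ++ [y] ++ R) := by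
  intro l hl hne hlen
  have key : ∀ s p : List G, s <:+ L → p <+: [y] ++ R → s ++ p ≠ [] → (s ++ p).length ≤ t →
      (s ++ p).sum ≠ 0 := by
    intro s p hs hp hne hlen
    rcases p with _ | ⟨z, p⟩
    · rw [List.append_nil] at *
      exact hL s hs.isInfix hne hlen
    · obtain ⟨rfl, hpR⟩ := List.cons_prefix_cons.mp hp
      have := hy s p hs hpR (by simp at hlen; omega)
      simpa [add_assoc] using this
  rw [List.append_assoc] at hl
  rcases List.infix_append_iff.mp hl with h | h | ⟨l₁, l₂, rfl, h₁, h₂⟩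
  · exact hL l h hne hlen
  · rcases List.infix_cons_iff.mp h with h | h
    · exact key [] l List.nil_suffix h hne hlen
    · exact hR l h hne hlen
  · exact key _ _ h₁ h₂ hne hlen

/-- Only boundedly many elements cannot be put between two lists. -/
lemma exists_forbidden {L R : List G} (hL : ShortSumsNeZero t L)
    (hR : ShortSumsNeZero t R) :
    ∃ F : Finset G, F.card ≤ t * t ∧ ∀ y, y ∉ F → ShortSumsNeZero t (L ++ [y] ++ R) := by
  classical
  refine ⟨((Finset.range t) ×ˢ (Finset.range t)).image fun ij =>
    -(L.drop (L.length - ij.1)).sum + -(R.take ij.2).sum,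
    Finset.card_image_le.trans (by simp), fun y hy => insert hL hR fun s p hs hp hlt h0 => hy ?_⟩
  refine Finset.mem_image.mpr ⟨(s.length, p.length), by simp; omega, ?_⟩
  dsimp only
  rw [← List.suffix_iff_eq_drop.mp hs, ← List.prefix_iff_eq_take.mp hp,
    ← sub_eq_add_neg, sub_eq_iff_eq_add, neg_eq_iff_add_eq_zero, ← add_assoc, h0]

/-- A slot, followed and preceded by anything, may be filled. -/
lemma fill_slot {A v o v' C : List G} (h : ShortSumsNeZero t (A ++ (v ++ v') ++ C))
    (ho : ShortSumsNeZero t (v ++ o ++ v')) (hv : t ≤ v.length) (hv' : t ≤ v'.length) :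
    ShortSumsNeZero t (A ++ (v ++ o ++ v') ++ C) := by
  have h₁ : ShortSumsNeZero t (A ++ v) := h.of_infix ⟨[], v' ++ C, by simp⟩
  have h₂ : ShortSumsNeZero t (v' ++ C) := h.of_infix ⟨A ++ v, [], by simp⟩
  have h₃ : ShortSumsNeZero t (A ++ v ++ (o ++ v')) := h₁.glue (by simpa using ho) hv
  have h₄ : ShortSumsNeZero t (A ++ v ++ o ++ v' ++ C) :=
    glue (by simpa using h₃) h₂ hv'
  simpa using h₄

lemma slot_of_mem {P Q : List G} {S : List (List G × List G)} {s : List G × List G}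
    (h : ShortSumsNeZero t (P ++ slotsJoin S ++ Q)) (hs : s ∈ S) :
    ShortSumsNeZero t (s.1 ++ s.2) := by
  obtain ⟨S₁, S₂, rfl⟩ := List.append_of_mem hs
  exact h.of_infix ⟨P ++ slotsJoin S₁, slotsJoin S₂ ++ Q, by simp [slotsJoin]⟩

end ShortSumsNeZero

section Fill

variable {G : Type*} [AddGroup G]

/-- Up to sign, `x` may be put into the slot `s`. -/
def Fits (t : ℕ) (x : G) (s : List G × List G) : Prop :=
  ∃ x', EqUpToSign x x' ∧ ShortSumsNeZero t (s.1 ++ [x'] ++ s.2)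

open Classical in
lemma exists_fill {t : ℕ} (Q : List G) (S : List (List G × List G)) (P : List G)
    (R : Multiset G) (hlen : ∀ s ∈ S, t ≤ s.1.length ∧ t ≤ s.2.length)
    (hS : ShortSumsNeZero t (P ++ slotsJoin S ++ Q))
    (hR : ∀ x ∈ R, R.card ≤ S.countP fun s => Fits t x s) :
    ∃ (F : List G) (R' : Multiset G), ShortSumsNeZero t (P ++ F ++ Q) ∧
      (F : Multiset G) = (slotsJoin S : Multiset G) + R' ∧ Multiset.Rel EqUpToSign R R' := by
  induction S generalizing P R with
  | nil =>
    have hR0 : R = 0 := Multiset.eq_zero_of_forall_notMem fun x hx => by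
      have := hR x hx
      simp only [List.countP_nil, Nat.le_zero, Multiset.card_eq_zero] at this
      simp [this] at hx
    subst hR0
    exact ⟨[], 0, by simpa [slotsJoin] using hS, by simp [slotsJoin], Multiset.Rel.zero⟩
  | cons s S ih =>
    obtain ⟨hs1, hs2⟩ := hlen s (by simp)
    have hlen' : ∀ s ∈ S, t ≤ s.1.length ∧ t ≤ s.2.length :=
      fun s hs => hlen s (List.mem_cons_of_mem _ hs)
    have hS' : ShortSumsNeZero t (P ++ (s.1 ++ s.2) ++ (slotsJoin S ++ Q)) := by
      simpa [slotsJoin] using hS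
    by_cases hex : ∃ x ∈ R, Fits t x s
    · obtain ⟨x, hx, x', hxx', hfit⟩ := hex
      obtain ⟨R₀, rfl⟩ := Multiset.exists_cons_of_mem hx
      obtain ⟨F, R', hF, hFR, hrel⟩ := ih (P ++ (s.1 ++ [x'] ++ s.2)) R₀ hlen'
        (by simpa using hS'.fill_slot hfit hs1 hs2) (fun y hy => by
          have := hR y (Multiset.mem_cons_of_mem hy)
          rw [Multiset.card_cons, List.countP_cons] at this
          split_ifs at this <;> omega)
      refine ⟨s.1 ++ [x'] ++ s.2 ++ F, x' ::ₘ R', by simpa using hF, ?_,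
        Multiset.Rel.cons hxx' hrel⟩
      have : slotsJoin (s :: S) = s.1 ++ s.2 ++ slotsJoin S := by simp [slotsJoin]
      rw [this]
      simp only [← Multiset.coe_add, hFR, ← Multiset.singleton_add, Multiset.coe_singleton]
      abel
    · obtain ⟨F, R', hF, hFR, hrel⟩ := ih (P ++ (s.1 ++ s.2)) R hlen'
        (by simpa using hS') (fun y hy => by
          have := hR y hy
          rwa [List.countP_cons, if_neg (by simpa using fun h => hex ⟨y, hy, h⟩)] at this)
      refine ⟨s.1 ++ s.2 ++ F, R', by simpa using hF, ?_, hrel⟩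
      have : slotsJoin (s :: S) = s.1 ++ s.2 ++ slotsJoin S := by simp [slotsJoin]
      rw [this]
      simp only [← Multiset.coe_add, hFR]
      abel

end Fill

section Greedy

variable {G : Type*}

open Classical in
lemma Multiset.card_toFinset_cons_le (x : G) (R : Multiset G) :
    (x ::ₘ R).toFinset.card ≤ R.toFinset.card + 1 := by
  rw [Multiset.toFinset_cons]
  exact Finset.card_insert_le _ _

open Classical in
lemma exists_greedy (Q : List G → Prop) (c n : ℕ) (h0 : Q [])
    (step : ∀ L : List G, Q L → ∃ F : Finset G, F.card ≤ c ∧ ∀ y, y ∉ F → Q (L ++ [y]))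
    (R : Multiset G) (hR : c + n ≤ R.toFinset.card) :
    ∃ (L : List G) (R' : Multiset G), L.length = n ∧ Q L ∧ (L : Multiset G) + R' = R ∧
      R.toFinset.card ≤ R'.toFinset.card + n := by
  induction n with
  | zero => exact ⟨[], R, rfl, h0, by simp, by simp⟩
  | succ n ih =>
    obtain ⟨L, R', hL, hQ, hLR, hc⟩ := ih (by omega)
    obtain ⟨F, hF, hstep⟩ := step L hQ
    obtain ⟨y, hy, hyF⟩ := Finset.exists_mem_notMem_of_card_lt_card
      (show F.card < R'.toFinset.card by omega)
    obtain ⟨R'', rfl⟩ := Multiset.exists_cons_of_mem (Multiset.mem_toFinset.mp hy)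
    have := Multiset.card_toFinset_cons_le y R''
    refine ⟨L ++ [y], R'', by simp [hL], hstep y hyF, ?_, by omega⟩
    rw [← hLR, ← Multiset.coe_add, Multiset.coe_singleton, ← Multiset.singleton_add, add_assoc]

open Classical in
lemma exists_greedy_exhaust [AddGroup G] {t : ℕ} (P : List G) (hP : ShortSumsNeZero t P)
    (R : Multiset G) :
    ∃ (L : List G) (R' : Multiset G), ShortSumsNeZero t (P ++ L) ∧ (L : Multiset G) + R' = R ∧
      R'.toFinset.card ≤ t * t := by
  induction h : R.card generalizing P R with
  | zero => exact ⟨[], R, by simpa using hP, by simp, by simp [Multiset.card_eq_zero.mp h]⟩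
  | succ n ih =>
    by_cases hR : R.toFinset.card ≤ t * t
    · exact ⟨[], R, by simpa using hP, by simp, hR⟩
    obtain ⟨F, hF, hstep⟩ := hP.exists_forbidden .nil
    obtain ⟨y, hy, hyF⟩ := Finset.exists_mem_notMem_of_card_lt_card
      (show F.card < R.toFinset.card by omega)
    obtain ⟨R₀, rfl⟩ := Multiset.exists_cons_of_mem (Multiset.mem_toFinset.mp hy)
    obtain ⟨L, R', hL, hLR, hc⟩ := ih (P ++ [y]) (by simpa using hstep y hyF) R₀ (by simpa using h)
    refine ⟨y :: L, R', by simpa using hL, ?_, hc⟩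
    rw [← hLR, ← Multiset.cons_coe, Multiset.cons_add]

variable [AddGroup G] {t : ℕ}

open Classical in
/-- Greedy construction of a slot into which each element of `X` fits. -/
lemma exists_slot (X : Finset G) (hX : ∀ x ∈ X, x ≠ 0) (P : List G)
    (hP : ShortSumsNeZero t P) (R : Multiset G)
    (hR : t * t + X.card * (t * t) + 2 * t ≤ R.toFinset.card) :
    ∃ (s : List G × List G) (R' : Multiset G), t ≤ s.1.length ∧ t ≤ s.2.length ∧
      ShortSumsNeZero t (P ++ (s.1 ++ s.2)) ∧
      (∀ x ∈ X, ShortSumsNeZero t (s.1 ++ [x] ++ s.2)) ∧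
      ((s.1 ++ s.2 : List G) : Multiset G) + R' = R ∧
      R.toFinset.card ≤ R'.toFinset.card + 2 * t := by
  obtain ⟨L, R', hlen, ⟨hL, hfit⟩, hLR, hc⟩ := exists_greedy
    (fun L => ShortSumsNeZero t (P ++ L) ∧
      ∀ x ∈ X, ShortSumsNeZero t (L.take t ++ [x] ++ L.drop t)) (t * t + X.card * (t * t)) (2 * t)
    ⟨by simpa using hP, fun x hx => by
      have := ShortSumsNeZero.insert (t := t) (y := x) .nil .nil (fun s p hs hp _ => by
        simpa [List.suffix_nil.mp hs, List.prefix_nil.mp hp] using hX x hx)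
      simpa using this⟩ (fun L ⟨hPL, hXL⟩ => by
      have hstep : ∀ x : G, ∃ F : Finset G, F.card ≤ t * t ∧ (x ∈ X → ∀ y, y ∉ F →
          ShortSumsNeZero t (L ++ [y]) →
          ShortSumsNeZero t ((L ++ [y]).take t ++ [x] ++ (L ++ [y]).drop t)) := by
        intro x
        by_cases hx : x ∈ X
        swap
        · exact ⟨∅, by simp, fun h => absurd h hx⟩
        rcases lt_or_ge L.length t with hlt | hge
        · have hXx := hXL x hx
          rw [List.take_of_length_le hlt.le, List.drop_of_length_le hlt.le,
            List.append_nil] at hXx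
          have hx1 : ShortSumsNeZero t [x] := hXx.of_infix List.infix_append_right
          obtain ⟨F, hF, hFy⟩ := (hPL.of_infix List.infix_append_right).exists_forbidden hx1
          refine ⟨F, hF, fun _ y hy _ => ?_⟩
          rw [List.take_of_length_le (by simp; omega), List.drop_of_length_le (by simp; omega),
            List.append_nil]
          exact hFy y hy
        · obtain ⟨F, hF, hFy⟩ := (hXL x hx).exists_forbidden .nil
          refine ⟨F, hF, fun _ y hy _ => ?_⟩
          rw [List.take_append_of_le_length hge, List.drop_append_of_le_length hge]
          simpa using hFy y hy
      choose F hF hFy using hstep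
      obtain ⟨F₀, hF₀, hFy₀⟩ := hPL.exists_forbidden .nil
      refine ⟨F₀ ∪ X.biUnion F, (Finset.card_union_le _ _).trans
        (add_le_add hF₀ (Finset.card_biUnion_le_card_mul _ _ _ fun x _ => hF x)),
        fun y hy => ?_⟩
      simp only [Finset.mem_union, Finset.mem_biUnion, not_or, not_exists, not_and] at hy
      have hPy : ShortSumsNeZero t (P ++ (L ++ [y])) := by simpa using hFy₀ y hy.1
      exact ⟨hPy, fun x hx => hFy x hx y (hy.2 x hx)
        (hPy.of_infix List.infix_append_right)⟩) R hR
  exact ⟨(L.take t, L.drop t), R', by simp; omega, by simp; omega, by simpa using hL, hfit,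
    by simpa using hLR, hc⟩

open Classical in
lemma exists_slots (X : Finset G) (hX : ∀ x ∈ X, x ≠ 0) (m : ℕ) (P : List G)
    (hP : ShortSumsNeZero t P) (R : Multiset G)
    (hR : t * t + X.card * (t * t) + 2 * t * m ≤ R.toFinset.card) :
    ∃ (S : List (List G × List G)) (R' : Multiset G), S.length = m ∧
      (∀ s ∈ S, t ≤ s.1.length ∧ t ≤ s.2.length) ∧
      ShortSumsNeZero t (P ++ slotsJoin S) ∧
      (∀ s ∈ S, ∀ x ∈ X, ShortSumsNeZero t (s.1 ++ [x] ++ s.2)) ∧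
      (slotsJoin S : Multiset G) + R' = R ∧
      R.toFinset.card ≤ R'.toFinset.card + 2 * t * m := by
  induction m generalizing P R with
  | zero => exact ⟨[], R, rfl, by simp, by simpa [slotsJoin], by simp, by simp [slotsJoin], by simp⟩
  | succ m ih =>
    rw [mul_add, mul_one] at hR
    obtain ⟨s, R₁, h1, h2, hPs, hfit, hsR, hc⟩ := exists_slot X hX P hP R
      (by omega)
    obtain ⟨S, R', hlen, hlens, hPS, hfits, hSR, hcs⟩ := ih _ hPs R₁ (by omega)
    refine ⟨s :: S, R', by simp [hlen], ?_, by simpa [slotsJoin] using hPS, ?_, ?_, ?_⟩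
    · rintro s' (_ | ⟨_, hs'⟩)
      exacts [⟨h1, h2⟩, hlens _ hs']
    · rintro s' (_ | ⟨_, hs'⟩)
      exacts [hfit, hfits _ hs']
    · rw [← hsR, ← hSR, ← add_assoc, Multiset.coe_add]
      simp [slotsJoin]
    · rw [mul_add, mul_one]; omega

open Classical in
/-- Double counting: few elements fail to fit into many slots. -/
lemma sum_countP_not_fits_le (X : Finset G) (S : List (List G × List G))
    (hS : ∀ s ∈ S, ShortSumsNeZero t (s.1 ++ s.2)) :
    ∑ x ∈ X, S.countP (fun s => ¬ Fits t x s) ≤ S.length * (t * t) := by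
  induction S with
  | nil => simp
  | cons s S ih =>
    have hs := hS s (by simp)
    obtain ⟨F, hF, hFy⟩ := (hs.of_infix List.infix_append_left).exists_forbidden
      (hs.of_infix List.infix_append_right)
    have hcard : ∑ x ∈ X, (if ¬ Fits t x s then 1 else 0) ≤ t * t := by
      rw [← Finset.card_filter]
      refine (Finset.card_le_card fun x hx => ?_).trans hF
      by_contra hxF
      exact (Finset.mem_filter.mp hx).2 ⟨x, .inl rfl, hFy x hxF⟩
    simp only [List.countP_cons, Finset.sum_add_distrib, List.length_cons, add_mul, one_mul,
      decide_eq_true_eq]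
    exact add_le_add (ih fun s hs => hS s (List.mem_cons_of_mem _ hs)) hcard

end Greedy

section Signs

variable {G : Type*} [AddGroup G] {t : ℕ}

lemma nsmul_ne_zero_of_lt_prime_divisors [Fintype G] {B : ℕ}
    (hG : ∀ p : ℕ, p.Prime → p ∣ Fintype.card G → B < p) {a : G} (ha : a ≠ 0) {n : ℕ}
    (hn : 0 < n) (hnB : n ≤ B) : n • a ≠ 0 := by
  intro h
  have hdvd := addOrderOf_dvd_of_nsmul_eq_zero h
  have hne : addOrderOf a ≠ 1 := fun h => ha (AddMonoid.addOrderOf_eq_one_iff.mp h)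
  have hlt := hG _ (Nat.minFac_prime hne) ((Nat.minFac_dvd _).trans addOrderOf_dvd_card)
  have := Nat.le_of_dvd hn ((Nat.minFac_dvd _).trans hdvd)
  omega

lemma exists_sign_nsmul_add_nsmul_ne_zero
    (hG : ∀ a : G, a ≠ 0 → ∀ n : ℕ, 0 < n → n ≤ t * (2 * t + 1) → n • a ≠ 0)
    {a b : G} (ha : a ≠ 0) (hb : b ≠ 0) :
    ∃ b', EqUpToSign b b' ∧ ∀ i j : ℕ, 0 < i + j → i + j ≤ t → i • b' + j • a ≠ 0 := by
  by_contra! hcon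
  obtain ⟨i, j, h0, ht, h⟩ := hcon b (.inl rfl)
  obtain ⟨i', j', h0', ht', h'⟩ := hcon (-b) (.inr rfl)
  have hle : ∀ {n : ℕ}, n ≤ t → n ≤ t * (2 * t + 1) := fun h => by nlinarith
  have pos : ∀ {b : G} {i j : ℕ}, b ≠ 0 → 0 < i + j → i + j ≤ t → i • b + j • a = 0 →
      0 < j := by
    intro b i j hb h0 ht h
    by_contra hj
    obtain rfl : j = 0 := by omega
    exact hG b hb i (by omega) (hle (by omega)) (by simpa using h)
  have pos' : 0 < i := by
    by_contra hi
    obtain rfl : i = 0 := by omega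
    exact hG a ha j (by omega) (hle (by omega)) (by simpa using h)
  have hj := pos hb h0 ht h
  have hj' := pos (neg_ne_zero.mpr hb) h0' ht' h'
  have e₁ : i • b = -(j • a) := eq_neg_of_add_eq_zero_left h
  have e₂ : i' • b = j' • a := by
    simpa using eq_neg_of_add_eq_zero_left h'
  have e₃ : (i' * j + i * j') • a = 0 := by
    have h₁ : (i' * i) • b = -((i' * j) • a) := by
      rw [mul_nsmul', e₁, neg_nsmul, ← mul_nsmul']
    have h₂ : (i' * i) • b = (i * j') • a := by
      rw [mul_comm, mul_nsmul', e₂, ← mul_nsmul']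
    rw [add_nsmul, ← h₂, h₁, add_neg_cancel]
  refine hG a ha _ (by positivity) ?_ e₃
  have : i' * j + i * j' ≤ (i + j) * (i' + j') := by
    nlinarith [Nat.zero_le (i * i'), Nat.zero_le (j * j')]
  have := Nat.mul_le_mul ht ht'
  nlinarith

lemma shortSumsNeZero_replicate
    (hG : ∀ a : G, a ≠ 0 → ∀ n : ℕ, 0 < n → n ≤ t * (2 * t + 1) → n • a ≠ 0)
    {a : G} (ha : a ≠ 0) (n : ℕ) :
    ShortSumsNeZero t (List.replicate n a) := by
  intro l hl hne hlen
  rw [(List.infix_replicate_iff.mp hl).2, List.sum_replicate]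
  exact hG a ha _ (List.length_pos_iff.mpr hne) (by nlinarith)

lemma exists_sign_replicate_append
    (hG : ∀ a : G, a ≠ 0 → ∀ n : ℕ, 0 < n → n ≤ t * (2 * t + 1) → n • a ≠ 0)
    {a b : G} (ha : a ≠ 0) (hb : b ≠ 0) (m n : ℕ) :
    ∃ b', EqUpToSign b b' ∧
      ShortSumsNeZero t (List.replicate m b' ++ List.replicate n a) := by
  obtain ⟨b', hbb', h⟩ := exists_sign_nsmul_add_nsmul_ne_zero hG ha hb
  refine ⟨b', hbb', fun l hl hne hlen => ?_⟩
  have hb' : b' ≠ 0 := by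
    rcases hbb' with rfl | rfl
    exacts [hb, neg_ne_zero.mpr hb]
  rcases List.infix_append_iff.mp hl with h | h | ⟨l₁, l₂, rfl, h₁, h₂⟩
  · exact shortSumsNeZero_replicate hG hb' m l h hne hlen
  · exact shortSumsNeZero_replicate hG ha n l h hne hlen
  · have := List.length_pos_iff.mpr hne
    rw [List.sum_append, (List.suffix_replicate_iff.mp h₁).2, (List.prefix_replicate_iff.mp h₂).2,
      List.sum_replicate, List.sum_replicate]
    exact h _ _ (by simpa using this) (by simpa using hlen)

lemma fits_replicate
    (hG : ∀ a : G, a ≠ 0 → ∀ n : ℕ, 0 < n → n ≤ t * (2 * t + 1) → n • a ≠ 0)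
    {a x : G} (ha : a ≠ 0) (hx : x ≠ 0) :
    Fits t x (List.replicate t a, List.replicate t a) := by
  have hor : (∀ i j : ℕ, i + j < t → i • a + x + j • a ≠ 0) ∨
      (∀ i j : ℕ, i + j < t → i • a + -x + j • a ≠ 0) := by
    by_contra! hcon
    obtain ⟨⟨i, j, hij, h⟩, ⟨i', j', hij', h'⟩⟩ := hcon
    have solve : ∀ {y : G} {i j : ℕ}, i • a + y + j • a = 0 → y = -((i + j) • a) := by
      intro y i j h
      rw [add_comm i j, add_nsmul, neg_add_rev, ← eq_neg_of_add_eq_zero_left h,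
        neg_add_cancel_left]
    have e := solve h
    have e' := solve h'
    rw [e, neg_neg] at e'
    have hz : (i + j + (i' + j')) • a = 0 := by
      rw [add_nsmul, e', neg_add_cancel]
    rcases Nat.eq_zero_or_pos (i + j + (i' + j')) with h0 | h0
    · exact hx (by rw [e, show i + j = 0 by omega]; simp)
    · exact hG a ha _ h0 (by nlinarith) hz
  have hrep := shortSumsNeZero_replicate hG ha t
  have key : ∀ y : G, (∀ i j : ℕ, i + j < t → i • a + y + j • a ≠ 0) →
      ShortSumsNeZero t (List.replicate t a ++ [y] ++ List.replicate t a) := by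
    intro y hy
    refine hrep.insert hrep fun s p hs hp hlt => ?_
    rw [(List.suffix_replicate_iff.mp hs).2, (List.prefix_replicate_iff.mp hp).2,
      List.sum_replicate, List.sum_replicate]
    exact hy _ _ hlt
  rcases hor with h | h
  exacts [⟨x, .inl rfl, key x h⟩, ⟨-x, .inr rfl, key _ h⟩]

/-- Blocks of `2 * t` equal elements can be arranged, with suitable signs, as slots into which
every nonzero element fits. -/
lemma exists_replicate_slots
    (hG : ∀ a : G, a ≠ 0 → ∀ n : ℕ, 0 < n → n ≤ t * (2 * t + 1) → n • a ≠ 0)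
    (A : List G) (hA : ∀ a ∈ A, a ≠ 0) :
    ∃ S : List (List G × List G), S.length = A.length ∧
      (∀ s ∈ S, t ≤ s.1.length ∧ t ≤ s.2.length) ∧ ShortSumsNeZero t (slotsJoin S) ∧
      (∀ s ∈ S, ∀ x, x ≠ 0 → Fits t x s) ∧
      Multiset.Rel EqUpToSign (A.flatMap (List.replicate (2 * t)) : Multiset G)
        (slotsJoin S : Multiset G) := by
  suffices h : ∃ B : List G, (∀ b ∈ B, b ≠ 0) ∧ B.length = A.length ∧
      ShortSumsNeZero t (B.flatMap (List.replicate (2 * t))) ∧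
      Multiset.Rel EqUpToSign (A.flatMap (List.replicate (2 * t)) : Multiset G)
        (B.flatMap (List.replicate (2 * t)) : Multiset G) by
    obtain ⟨B, hB, hlen, hgood, hrel⟩ := h
    have hjoin : slotsJoin (B.map fun b => (List.replicate t b, List.replicate t b)) =
        B.flatMap (List.replicate (2 * t)) := by
      simp only [slotsJoin, List.flatMap_map, List.replicate_append_replicate, two_mul]
    refine ⟨_, (List.length_map _).trans hlen, ?_, hjoin ▸ hgood, ?_, hjoin ▸ hrel⟩
    · simp
    · simp only [List.mem_map, forall_exists_index, and_imp, forall_apply_eq_imp_iff₂]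
      exact fun b hb x hx => fits_replicate hG (hB b hb) hx
  induction A with
  | nil => exact ⟨[], by simp, rfl, by simpa using ShortSumsNeZero.nil, by simp⟩
  | cons a A ih =>
    obtain ⟨B, hB, hlen, hgood, hrel⟩ := ih fun a ha => hA a (List.mem_cons_of_mem _ ha)
    have ha : a ≠ 0 := hA a (by simp)
    obtain ⟨a', haa', hgood'⟩ : ∃ a', EqUpToSign a a' ∧
        ShortSumsNeZero t ((a' :: B).flatMap (List.replicate (2 * t))) := by
      rcases B with _ | ⟨b, B⟩
      · exact ⟨a, .inl rfl, by simpa using shortSumsNeZero_replicate hG ha (2 * t)⟩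
      · obtain ⟨a', haa', h⟩ :=
          exists_sign_replicate_append hG (hB b (by simp)) ha (2 * t) (2 * t)
        refine ⟨a', haa', ?_⟩
        have := h.glue (C := B.flatMap (List.replicate (2 * t))) (by simpa using hgood)
          (by simp; omega)
        simpa using this
    refine ⟨a' :: B, ?_, by simp [hlen], hgood', ?_⟩
    · rintro b (_ | ⟨_, hb⟩)
      · rcases haa' with rfl | rfl
        exacts [ha, neg_ne_zero.mpr ha]
      · exact hB b hb
    · rw [List.flatMap_cons, List.flatMap_cons, ← Multiset.coe_add, ← Multiset.coe_add]
      refine Multiset.Rel.add ?_ hrel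
      rw [Multiset.coe_replicate, Multiset.coe_replicate, Multiset.rel_replicate_left]
      simp only [Multiset.card_replicate, true_and]
      exact fun x hx => Multiset.eq_of_mem_replicate hx ▸ haa'

end Signs

section Assembly

variable {G : Type*}

open Classical in
lemma exists_blocks_add_remainder {k : ℕ} (hk : 0 < k) (M : Multiset G) :
    ∃ (A : List G) (T : Multiset G), M = (A.flatMap (List.replicate k) : Multiset G) + T ∧
      ∀ x, T.count x ≤ k := by
  induction h : M.card using Nat.strong_induction_on generalizing M with
  | _ n ih =>
    by_cases hM : ∀ x, M.count x ≤ k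
    · exact ⟨[], M, by simp, hM⟩
    push Not at hM
    obtain ⟨x, hx⟩ := hM
    obtain ⟨M', rfl⟩ := Multiset.le_iff_exists_add.mp (Multiset.le_count_iff_replicate_le.mp hx.le)
    obtain ⟨A, T, rfl, hT⟩ := ih _ (by rw [← h]; simp; omega) M' rfl
    refine ⟨x :: A, T, ?_, hT⟩
    rw [List.flatMap_cons, ← Multiset.coe_add, Multiset.coe_replicate, add_assoc]

open Classical in
lemma Multiset.card_le_card_toFinset_mul {k : ℕ} {T : Multiset G} (hT : ∀ x, T.count x ≤ k) :
    T.card ≤ T.toFinset.card * k := by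
  rw [← Multiset.toFinset_sum_count_eq]
  exact Finset.sum_le_card_nsmul _ _ _ fun x _ => hT x

variable [AddGroup G] {t : ℕ}

lemma Multiset.rel_eqUpToSign_refl (R : Multiset G) : Multiset.Rel EqUpToSign R R :=
  Multiset.rel_refl_of_refl_on fun _ _ => .inl rfl

open Classical in
/-- A multiset with small multiplicities and many elements can be appended, up to signs. -/
lemma exists_append_of_count_le (ht : 0 < t) (P : List G) (hP : ShortSumsNeZero t P)
    (T : Multiset G) (hT0 : ∀ x ∈ T, x ≠ 0) (hT : ∀ x, T.count x ≤ 2 * t)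
    (hcard : t * t + 2 * (t * t) * (t * t) + 2 * t * (3 * (t * t * (2 * t))) ≤ T.toFinset.card) :
    ∃ (L : List G), ShortSumsNeZero t (P ++ L) ∧ Multiset.Rel EqUpToSign T (L : Multiset G) := by
  set D := t * t * (2 * t)
  have hDpos : 0 < D := by positivity
  obtain ⟨S₁, T₁, hlen₁, hlens₁, hgood₁, -, hT₁, hc₁⟩ :=
    exists_slots (t := t) ∅ (by simp) (2 * D) P hP T (by
      simp only [Finset.card_empty, zero_mul, add_zero]
      refine le_trans ?_ hcard
      nlinarith [Nat.zero_le (2 * (t * t) * (t * t)), Nat.zero_le (t * D)])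
  set X := T.toFinset.filter fun x => S₁.countP (fun s => Fits t x s) < D
  have hXcard : X.card ≤ 2 * (t * t) := by
    have h₁ := sum_countP_not_fits_le X S₁ fun s hs =>
      ShortSumsNeZero.slot_of_mem (P := P) (Q := []) (by simpa using hgood₁) hs
    have h₂ : X.card * D ≤ ∑ x ∈ X, S₁.countP (fun s => ¬ Fits t x s) := by
      refine Finset.card_nsmul_le_sum _ _ _ fun x hx => ?_
      have h₃ := (Finset.mem_filter.mp hx).2
      have h₄ := List.length_eq_countP_add_countP (fun s => decide (Fits t x s)) (l := S₁)
      have h₅ : S₁.countP (fun s => ¬ Fits t x s) =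
          S₁.countP (fun s => ¬ decide (Fits t x s) = true) := by simp
      omega
    have h₃ := h₂.trans h₁
    rw [hlen₁] at h₃
    exact Nat.le_of_mul_le_mul_right (by linarith) hDpos
  obtain ⟨S₂, T₂, hlen₂, hlens₂, hgood₂, hfit₂, hT₂, hc₂⟩ :=
    exists_slots (t := t) X (fun x hx => hT0 x (by simpa using (Finset.mem_filter.mp hx).1)) D
      (P ++ slotsJoin S₁) hgood₁ T₁ (by
        have := Nat.mul_le_mul_right (t * t) hXcard
        nlinarith)
  obtain ⟨Q, R, hQ, hQR, hRc⟩ := exists_greedy_exhaust _ hgood₂ T₂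
  have hRT : R ≤ T := by
    rw [← hT₁, ← hT₂, ← hQR]
    exact le_add_left (le_add_left (Multiset.le_add_left _ _))
  have hRcard : R.card ≤ D := (Multiset.card_le_card_toFinset_mul fun x =>
    (Multiset.count_le_of_le x hRT).trans (hT x)).trans (Nat.mul_le_mul_right _ hRc)
  have hjoin : slotsJoin (S₁ ++ S₂) = slotsJoin S₁ ++ slotsJoin S₂ := by simp [slotsJoin]
  obtain ⟨F, R', hF, hFR, hrel⟩ := exists_fill (t := t) Q (S₁ ++ S₂) P R
    (fun s hs => (List.mem_append.mp hs).elim (hlens₁ s) (hlens₂ s))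
    (by simpa [hjoin] using hQ) (fun x hx => by
      refine hRcard.trans ?_
      rw [List.countP_append]
      by_cases hxX : x ∈ X
      · have : S₂.countP (fun s => Fits t x s) = S₂.length :=
          List.countP_eq_length.mpr fun s hs => by
            simpa using ⟨x, .inl rfl, hfit₂ s hs x hxX⟩
        omega
      · have : ¬ S₁.countP (fun s => Fits t x s) < D := fun h =>
          hxX (Finset.mem_filter.mpr ⟨by simpa using Multiset.mem_of_le hRT hx, h⟩)
        omega)
  refine ⟨F ++ Q, by simpa using hF, ?_⟩
  have hT' : T = ((slotsJoin (S₁ ++ S₂) : Multiset G) + R) + (Q : Multiset G) := by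
    rw [← hT₁, ← hT₂, ← hQR, hjoin, ← Multiset.coe_add]
    abel
  rw [hT', ← Multiset.coe_add, hFR]
  exact ((Multiset.rel_eqUpToSign_refl _).add hrel).add (Multiset.rel_eqUpToSign_refl _)

lemma exists_signs_of_rel (L : List G) (M : Multiset G)
    (h : Multiset.Rel EqUpToSign M (L : Multiset G)) :
    ∃ ε : ℕ → ℤˣ, (Multiset.range L.length).map (fun i => (ε i : ℤ) • L.getD i 0) = M := by
  induction L generalizing M with
  | nil => exact ⟨1, by simpa using (Multiset.rel_zero_right.mp h).symm⟩
  | cons a L ih =>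
    rw [← Multiset.cons_coe, Multiset.rel_cons_right] at h
    obtain ⟨x, M', hxa, hM', rfl⟩ := h
    obtain ⟨ε, hε⟩ := ih M' hM'
    obtain ⟨u, hu⟩ : ∃ u : ℤˣ, (u : ℤ) • a = x := by
      rcases hxa with rfl | rfl
      exacts [⟨1, by simp⟩, ⟨-1, by simp⟩]
    refine ⟨fun i => Nat.casesOn i u ε, ?_⟩
    rw [← hε, List.length_cons, Multiset.range, List.range_succ_eq_map, ← Multiset.cons_coe,
      Multiset.map_cons]
    simp [hu, Multiset.range, Function.comp_def]

lemma exists_realization_of_rel (L : List G) (hL : ShortSumsNeZero t L) (M : Multiset G)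
    (h : Multiset.Rel EqUpToSign M (L : Multiset G)) :
    ∃ w : ℕ → G, IsRealization M w ∧
      ∀ i j : ℕ, i < j → j ≤ Multiset.card M → j - i ≤ t → w i ≠ w j := by
  obtain ⟨ε, hε⟩ := exists_signs_of_rel L M h
  have hcard : M.card = L.length := by simpa using Multiset.card_eq_card_of_rel h
  refine ⟨fun i => (L.take i).sum, ⟨by simp, ε, ?_⟩, fun i j hij hj hijt heq => ?_⟩
  · rw [hcard]
    conv_rhs => rw [← hε]
    refine Multiset.map_congr rfl fun i hi => ?_
    have hi' : i < L.length := Multiset.mem_range.mp hi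
    dsimp only
    rw [List.sum_take_succ L i hi', neg_add_cancel_left, List.getD_eq_getElem _ _ hi']
  · have hsplit : L.take i ++ (L.take j).drop i = L.take j := by
      conv_rhs => rw [← List.take_append_drop i (L.take j)]
      rw [List.take_take, min_eq_left hij.le]
    have hlen : ((L.take j).drop i).length = j - i := by simp; omega
    refine hL ((L.take j).drop i)
      ((List.drop_suffix _ _).isInfix.trans (List.take_prefix _ _).isInfix)
      (List.ne_nil_of_length_pos (by omega)) (by omega) ?_
    have := congrArg List.sum hsplit
    rw [List.sum_append, ← show (L.take i).sum = (L.take j).sum from heq] at this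
    simpa using this

end Assembly

/-- For every positive integer `t` there is `N` such that: for any finite group `G`
whose smallest prime divisor of `|G|` is larger than `t(2t+1)`, every multiset `M`
of non-identity elements of `G` with `|M| ≥ N` admits a realization
`W = (w₀, …, w_{|M|})` with `w_i ≠ w_j` whenever `1 ≤ |i - j| ≤ t`. -/
theorem weak_BHR (t : ℕ) (ht : 0 < t) :
    ∃ N : ℕ, ∀ (G : Type*) [AddGroup G] [Fintype G],
      (∀ p : ℕ, p.Prime → p ∣ Fintype.card G → t * (2 * t + 1) < p) →
      ∀ M : Multiset G, (∀ x ∈ M, x ≠ (0 : G)) →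
        N ≤ Multiset.card M →
        ∃ w : ℕ → G, IsRealization M w ∧
          ∀ i j : ℕ, i < j → j ≤ Multiset.card M → j - i ≤ t → w i ≠ w j := by
  classical
  set C := t * t + 2 * (t * t) * (t * t) + 2 * t * (3 * (t * t * (2 * t))) with hC
  refine ⟨(2 * t + 1) * (C * (2 * t)), fun G _ _ hG M hM hcard => ?_⟩
  have hG' : ∀ a : G, a ≠ 0 → ∀ n : ℕ, 0 < n → n ≤ t * (2 * t + 1) → n • a ≠ 0 :=
    fun a ha n hn hnt => nsmul_ne_zero_of_lt_prime_divisors hG ha hn hnt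
  suffices h : ∃ L : List G, ShortSumsNeZero t L ∧
      Multiset.Rel EqUpToSign M (L : Multiset G) by
    obtain ⟨L, hL, hrel⟩ := h
    exact exists_realization_of_rel L hL M hrel
  obtain ⟨A, T, rfl, hT⟩ := exists_blocks_add_remainder (show 0 < 2 * t by omega) M
  have hA0 : ∀ a ∈ A, a ≠ 0 := fun a ha => hM a (Multiset.mem_add.mpr (.inl
    (by simpa using ⟨ha, ht.ne'⟩)))
  have hT0 : ∀ x ∈ T, x ≠ 0 := fun x hx => hM x (Multiset.mem_add.mpr (.inr hx))
  obtain ⟨S, hSlen, hSlens, hSgood, hSfits, hSrel⟩ := exists_replicate_slots hG' A hA0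
  rcases le_or_gt T.card A.length with hle | hgt
  · obtain ⟨F, T', hF, hFT, hrel⟩ := exists_fill (t := t) [] S [] T hSlens (by simpa using hSgood)
      (fun x hx => by
        rw [List.countP_eq_length.mpr fun s hs => by simpa using hSfits s hs x (hT0 x hx)]
        omega)
    exact ⟨F, by simpa using hF, hFT ▸ hSrel.add hrel⟩
  · have hTC : C ≤ T.toFinset.card := by
      have h₁ := Multiset.card_le_card_toFinset_mul hT
      have h₂ : (A.flatMap (List.replicate (2 * t))).length = A.length * (2 * t) := by simp
      rw [Multiset.card_add, Multiset.coe_card, h₂] at hcard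
      have h₃ := Nat.mul_le_mul_right (2 * t) hgt.le
      have h₄ : (2 * t + 1) * (C * (2 * t)) ≤ (2 * t + 1) * (T.toFinset.card * (2 * t)) := by
        nlinarith
      exact Nat.le_of_mul_le_mul_right (Nat.le_of_mul_le_mul_left h₄ (by omega)) (by omega)
    obtain ⟨L, hL, hrel⟩ := exists_append_of_count_le ht _ hSgood T hT0 hT hTC
    refine ⟨_, hL, ?_⟩
    rw [← Multiset.coe_add]
    exact hSrel.add hrel
end

section
/- Let t be a positive integer, let a_1 be an invertible element (a unit) of the ring Z_v of integers modulo v, and let d be a positive divisor of v such that v ≥ d·t·(2t+1). Let W = {0, a_1, 2a_1, …, t·a_1} ⊆ Z_v. Then either W is disjoint from {1, 2, …, dt} (the images in Z_v of the integers 1 through dt) or W is disjoint from {−1, −2, …, −dt} (the images in Z_v of the negatives of the integers 1 through dt). -/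
/-- Let `a₁` be a unit of `ZMod v` and `d` a positive divisor of `v` with
`v ≥ d·t·(2t+1)`. Then the walk `W = {0, a₁, 2a₁, …, t·a₁}` is disjoint either from
`{1, 2, …, dt}` or from `{-1, -2, …, -dt}` in `ZMod v`. -/
theorem walk_avoids_interval (v : ℕ) (hv : 0 < v) (t : ℕ) (ht : 0 < t)
    (a₁ : ZMod v) (ha : IsUnit a₁) (d : ℕ) (hd : 0 < d) (hdv : d ∣ v)
    (hbig : d * t * (2 * t + 1) ≤ v) :
    (∀ i : ℕ, i ≤ t → ∀ j : ℕ, 1 ≤ j → j ≤ d * t → i • a₁ ≠ ((j : ℕ) : ZMod v)) ∨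
    (∀ i : ℕ, i ≤ t → ∀ j : ℕ, 1 ≤ j → j ≤ d * t → i • a₁ ≠ -((j : ℕ) : ZMod v)) := by
  by_contra! h
  obtain ⟨⟨i, hi, x, hx, hxt, hix⟩, k, hk, y, hy, hyt, hky⟩ := h
  rw [nsmul_eq_mul] at hix hky
  have hdt : 0 < d * t := Nat.mul_pos hd ht
  have hkx : k * x ≤ t * (d * t) := Nat.mul_le_mul hk hxt
  have hiy : i * y ≤ t * (d * t) := Nat.mul_le_mul hi hyt
  have hzero : ((k * x + i * y : ℕ) : ZMod v) = 0 := by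
    push_cast
    linear_combination (-(k : ZMod v)) * hix + (i : ZMod v) * hky
  have hsum : k * x + i * y = 0 :=
    Nat.eq_zero_of_dvd_of_lt ((ZMod.natCast_eq_zero_iff _ _).mp hzero) (by nlinarith)
  have hi0 : i = 0 := by
    have : i * y = 0 := by omega
    rcases Nat.mul_eq_zero.mp this with h | h <;> omega
  have hx0 : (x : ZMod v) = 0 := by simpa [hi0] using hix.symm
  have := Nat.le_of_dvd hx ((ZMod.natCast_eq_zero_iff _ _).mp hx0)
  nlinarith
end

section
/- Let t be a positive integer and let (G,+) be a finite group (not necessarily abelian) whose smallest prime divisor of |G| is larger than t. Let M_1 = [a_1^{α_1}, a_2^{α_2}, …, a_n^{α_n}] and M_2 = [a_1^{β_1}, a_2^{β_2}, …, a_n^{β_n}] be multisets of non-identity elements of G (where the exponents α_i, β_i ≥ 0 are allowed to be zero) such that the underlying set of M_2 (the set of a_i with β_i ≥ 1) has size larger than 2t². Then there exists a t-weakly sequenceable multiset M_3 with M_1 ⊆ M_3 ⊆ M_1 ∪ M_2 and |M_3 ∖ M_1| ≤ t². -/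
theorem nsmul_ne_zero_of_card_primeFactors_gt {G : Type*} [AddGroup G] [Fintype G] {t : ℕ}
    (hp : ∀ p : ℕ, p.Prime → p ∣ Fintype.card G → t < p) {b : G} (hb : b ≠ 0) {k : ℕ}
    (hk : 0 < k) (hkt : k ≤ t) : k • b ≠ 0 := by
  intro h
  have hdvd : (addOrderOf b).minFac ∣ addOrderOf b := Nat.minFac_dvd _
  have hprime : (addOrderOf b).minFac.Prime :=
    Nat.minFac_prime (by rwa [Ne, AddMonoid.addOrderOf_eq_one_iff])
  have hlt := hp _ hprime (hdvd.trans addOrderOf_dvd_card)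
  have hle := Nat.le_of_dvd hk (hdvd.trans (addOrderOf_dvd_of_nsmul_eq_zero h))
  omega

theorem sum_take_append_cons_replicate {G : Type*} [AddGroup G] (l : List G) (z b : G)
    {γ k : ℕ} (hk : k ≤ γ) :
    ((l ++ z :: List.replicate γ b).take (l.length + 1 + k)).sum = l.sum + z + k • b := by
  rw [add_assoc, List.take_length_add_append, add_comm 1 k, List.take_succ_cons,
    List.take_replicate, min_eq_left hk]
  simp [add_assoc]

/-- A `t`-weak ordering stays one after appending a separator `z` and a constant run of `b`,
if `z` avoids the values making the sum of a short window through `z` vanish. -/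
theorem tWeakOrd.append_cons_replicate {G : Type*} [AddGroup G] {t : ℕ} {l : List G}
    (hl : tWeakOrd t l) {z b : G} {γ : ℕ}
    (hb : ∀ k, 0 < k → k ≤ t → k ≤ γ → k • b ≠ 0)
    (hz : ∀ w < t, ∀ k < t, k ≤ γ →
      z ≠ -l.sum + (l.take (l.length - w)).sum - k • b) :
    tWeakOrd t (l ++ z :: List.replicate γ b) := by
  intro i j hij hj hjt
  have hlen : (l ++ z :: List.replicate γ b).length = l.length + 1 + γ := by
    simp only [List.length_append, List.length_cons, List.length_replicate]
    omega
  rw [hlen] at hj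
  rcases le_or_gt j l.length with hjl | hjl
  · rw [List.take_append_of_le_length (by omega), List.take_append_of_le_length hjl]
    exact hl i j hij hjl hjt
  obtain ⟨k, rfl⟩ := Nat.exists_eq_add_of_le (Nat.succ_le_of_lt hjl)
  rw [Nat.succ_eq_add_one, sum_take_append_cons_replicate l z b (by omega)]
  rcases le_or_gt i l.length with hil | hil
  · rw [List.take_append_of_le_length hil]
    intro h
    refine hz (l.length - i) (by omega) k (by omega) (by omega) ?_
    rw [Nat.sub_sub_self hil, h]
    simp [add_assoc]
  · obtain ⟨m, rfl⟩ := Nat.exists_eq_add_of_le (Nat.succ_le_of_lt hil)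
    rw [Nat.succ_eq_add_one, sum_take_append_cons_replicate l z b (by omega)]
    intro h
    obtain ⟨d, rfl⟩ := Nat.exists_eq_add_of_le (show m ≤ k by omega)
    rw [add_right_inj, add_nsmul, left_eq_add] at h
    exact hb d (by omega) (by omega) (by omega) h

/-- Greedily extending a `t`-weak ordering `l` by elements of `R` gets stuck only when at most
`t` distinct elements remain. -/
theorem tWeakOrd.exists_greedy_extension {G : Type*} [AddGroup G] [DecidableEq G] {t : ℕ}
    (R : Multiset G) {l : List G} (hl : tWeakOrd t l) :
    ∃ (l' : List G) (R' : Multiset G), (l' : Multiset G) + R' = l + R ∧ R' ≤ R ∧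
      tWeakOrd t l' ∧ R'.toFinset.card ≤ t := by
  induction hn : Multiset.card R generalizing R l with
  | zero =>
    obtain rfl := Multiset.card_eq_zero.mp hn
    exact ⟨l, 0, rfl, le_rfl, hl, by simp⟩
  | succ n ih =>
    rcases le_or_gt R.toFinset.card t with h | h
    · exact ⟨l, R, rfl, le_rfl, hl, h⟩
    obtain ⟨z, hzR, hz⟩ := Finset.exists_mem_notMem_of_card_lt_card
      (s := (Finset.range t).image fun w => -l.sum + (l.take (l.length - w)).sum)
      (lt_of_le_of_lt (Finset.card_image_le.trans (Finset.card_range t).le) h)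
    rw [Multiset.mem_toFinset] at hzR
    have hl₁ : tWeakOrd t (l ++ [z]) := by
      refine hl.append_cons_replicate (b := 0) (γ := 0) (by omega) fun w hw k _ hk hzw => hz ?_
      obtain rfl : k = 0 := by omega
      exact Finset.mem_image.mpr ⟨w, Finset.mem_range.mpr hw, by simp [hzw]⟩
    obtain ⟨l', R', hsum, hle, hl', hcard⟩ :=
      ih (R.erase z) hl₁ (by rw [Multiset.card_erase_of_mem hzR, hn]; rfl)
    refine ⟨l', R', ?_, hle.trans (Multiset.erase_le z R), hl', hcard⟩
    rw [hsum, ← Multiset.coe_add, add_assoc, Multiset.coe_singleton, Multiset.singleton_add,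
      Multiset.cons_erase hzR]

/-- A `t`-weak ordering can be extended by all of `R`, arranged in constant runs, using one
separator from `S` for each distinct element of `R`. -/
theorem tWeakOrd.exists_separated_extension {G : Type*} [AddGroup G] [DecidableEq G] {t : ℕ}
    (R : Multiset G) (hR : ∀ b ∈ R, ∀ k, 0 < k → k ≤ t → k • b ≠ 0) (S : Finset G)
    (hS : t ^ 2 + R.toFinset.card ≤ S.card) {l : List G} (hl : tWeakOrd t l) :
    ∃ (l' : List G) (Z : Finset G), (l' : Multiset G) = l + R + Z.val ∧ Z ⊆ S ∧
      Z.card ≤ R.toFinset.card ∧ tWeakOrd t l' := by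
  induction hn : R.toFinset.card generalizing R S l with
  | zero =>
    obtain rfl : R = 0 := by simpa using hn
    exact ⟨l, ∅, by simp, by simp, by simp, hl⟩
  | succ n ih =>
    obtain ⟨b, hbR⟩ := Finset.card_pos.mp (by omega : 0 < R.toFinset.card)
    rw [Multiset.mem_toFinset] at hbR
    obtain ⟨z, hzS, hz⟩ := Finset.exists_mem_notMem_of_card_lt_card (t := S)
      (s := (Finset.range t ×ˢ Finset.range t).image fun p =>
        -l.sum + (l.take (l.length - p.1)).sum - p.2 • b)
      (lt_of_le_of_lt (Finset.card_image_le.trans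
        (by rw [Finset.card_product, Finset.card_range, ← sq] : _ ≤ t ^ 2)) (by omega))
    have hl₁ : tWeakOrd t (l ++ z :: List.replicate (R.count b) b) := by
      refine hl.append_cons_replicate (fun k hk hkt _ => hR b hbR k hk hkt)
        fun w hw k hk _ hzw => hz ?_
      exact Finset.mem_image.mpr ⟨(w, k), by simp [hw, hk], hzw.symm⟩
    have hfin : (R.filter (· ≠ b)).toFinset = R.toFinset.erase b := by
      ext x
      simp [and_comm]
    have hcard : (R.filter (· ≠ b)).toFinset.card = n := by
      rw [hfin, Finset.card_erase_of_mem (by simpa using hbR), hn]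
      rfl
    obtain ⟨l', Z, hsum, hZS, hZcard, hl'⟩ := ih (R.filter (· ≠ b))
      (fun x hx => hR x (Multiset.mem_of_mem_filter hx)) (S.erase z)
      (by rw [Finset.card_erase_of_mem hzS]; omega) hl₁ hcard
    have hzZ : z ∉ Z := fun h => by simpa using hZS h
    refine ⟨l', insert z Z, ?_, ?_, ?_, hl'⟩
    · have hsplit : Multiset.replicate (R.count b) b + R.filter (· ≠ b) = R := by
        rw [← Multiset.filter_eq', Multiset.filter_add_not]
      rw [hsum, Finset.insert_val_of_notMem hzZ, ← Multiset.coe_add, ← Multiset.cons_coe,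
        Multiset.coe_replicate]
      conv_rhs => rw [← hsplit]
      simp only [← Multiset.singleton_add]
      abel
    · exact Finset.insert_subset hzS (hZS.trans (Finset.erase_subset _ _))
    · rw [Finset.card_insert_of_notMem hzZ]
      omega

/-- Let `G` be a finite group whose smallest prime divisor of `|G|` is larger than `t`,
and let `M₁`, `M₂` be multisets of non-identity elements of `G` such that the underlying
set of `M₂` has more than `2t²` elements. Then there is a `t`-weakly sequenceable
multiset `M₃` with `M₁ ⊆ M₃ ⊆ M₁ ∪ M₂` and `|M₃ \ M₁| ≤ t²`. -/
theorem exists_weakly_sequenceable_between {G : Type*} [AddGroup G] [Fintype G]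
    [DecidableEq G] (t : ℕ) (ht : 0 < t)
    (hp : ∀ p : ℕ, p.Prime → p ∣ Fintype.card G → t < p)
    (M₁ M₂ : Multiset G)
    (hM₁ : ∀ x ∈ M₁, x ≠ (0 : G)) (hM₂ : ∀ x ∈ M₂, x ≠ (0 : G))
    (hcard : 2 * t ^ 2 < M₂.toFinset.card) :
    ∃ M₃ : Multiset G, M₁ ≤ M₃ ∧ M₃ ≤ M₁ + M₂ ∧
      Multiset.card (M₃ - M₁) ≤ t ^ 2 ∧ tWeakSequenceable t M₃ := by
  have hnil : tWeakOrd t ([] : List G) := fun i j hij hj _ => by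
    simp only [List.length_nil] at hj
    omega
  obtain ⟨l, R, hsum, hRle, hl, hRcard⟩ := hnil.exists_greedy_extension M₁
  rw [Multiset.coe_nil, zero_add] at hsum
  have htt : t ≤ t ^ 2 := Nat.le_self_pow two_ne_zero t
  obtain ⟨l', Z, hl'sum, hZ, hZcard, hl'⟩ := hl.exists_separated_extension R
    (fun b hb k hk hkt => nsmul_ne_zero_of_card_primeFactors_gt hp
      (hM₁ b (Multiset.mem_of_le hRle hb)) hk hkt) M₂.toFinset (by omega)
  rw [hsum] at hl'sum
  refine ⟨M₁ + Z.val, Multiset.le_add_right _ _, ?_, ?_, l', hl'sum, hl'⟩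
  · exact add_le_add_right ((Finset.val_le_iff.mpr hZ).trans (Multiset.dedup_le M₂)) M₁
  · rw [add_tsub_cancel_left, Finset.card_val]
    omega
end

section
/- Let M be a finite multiset of size m of non-identity elements of a group (G,+) (not necessarily abelian), let S be a finite set of k non-identity elements of G, and let h and t be positive integers such that h ≤ k − (t−1). Then, given any t-weak ordering (y_1, …, y_m) of M, there exist h pairwise distinct elements y_{m+1}, …, y_{m+h} of S such that (y_1, …, y_m, y_{m+1}, …, y_{m+h}) is a t-weak ordering of the multiset M ∪ {y_{m+1}, …, y_{m+h}}. -/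
/-- A `t`-weak ordering extended by an element `x` remains one if the new partial sum differs
from the last `t` partial sums. -/
theorem tWeakOrd.append_singleton {G : Type*} [AddGroup G] {t : ℕ} {l : List G} {x : G}
    (hl : tWeakOrd t l)
    (hx : ∀ i ≤ l.length, l.length + 1 - i ≤ t → (l.take i).sum ≠ l.sum + x) :
    tWeakOrd t (l ++ [x]) := by
  intro i j hij hj hjt
  simp only [List.length_append, List.length_singleton] at hj
  rw [List.take_append_of_le_length (by omega : i ≤ l.length)]
  rcases Nat.lt_or_ge l.length j with hlj | hjl
  · obtain rfl : j = l.length + 1 := by omega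
    rw [List.take_of_length_le (i := l.length + 1) (by simp), List.sum_append,
      List.sum_singleton]
    exact hx i (by omega) hjt
  · rw [List.take_append_of_le_length hjl]
    exact hl i j hij hjl hjt

/-- A `t`-weak ordering extends by a nonzero element of any finite set with at least `t`
elements. -/
theorem tWeakOrd.exists_append_singleton {G : Type*} [AddGroup G] {t : ℕ} {l : List G}
    (hl : tWeakOrd t l) {A : Finset G} (hA0 : ∀ x ∈ A, x ≠ 0) (hA : t - 1 < A.card) :
    ∃ x ∈ A, tWeakOrd t (l ++ [x]) := by
  classical
  let F : Finset G := (Finset.range (t - 1)).image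
    fun d => -l.sum + (l.take (l.length - (d + 1))).sum
  have hF : F.card < A.card :=
    (Finset.card_image_le.trans_eq (Finset.card_range _)).trans_lt hA
  obtain ⟨x, hxA, hxF⟩ := Finset.exists_mem_notMem_of_card_lt_card hF
  refine ⟨x, hxA, hl.append_singleton fun i hi hit heq => ?_⟩
  rcases hi.eq_or_lt with rfl | hi
  · rw [List.take_length] at heq
    exact hA0 x hxA (left_eq_add.mp heq)
  · refine hxF (Finset.mem_image.mpr ⟨l.length - i - 1, Finset.mem_range.mpr (by omega), ?_⟩)
    rw [show l.length - (l.length - i - 1 + 1) = i by omega, heq, neg_add_cancel_left]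

/-- Let `M` (given by a `t`-weak ordering `l`) be a multiset of non-identity elements,
`S` a finite set of non-identity elements, and `h`, `t` positive integers with
`h ≤ |S| - (t-1)`. Then one can append `h` pairwise distinct elements of `S` to `l`
obtaining a `t`-weak ordering of the enlarged multiset. -/
theorem extend_weak_ordering_by_h {G : Type*} [AddGroup G]
    (t h : ℕ) (ht : 0 < t) (hh : 0 < h)
    (l : List G) (hl0 : ∀ x ∈ l, x ≠ (0 : G)) (hl : tWeakOrd t l)
    (S : Finset G) (hS0 : ∀ x ∈ S, x ≠ (0 : G))
    (hhk : h + (t - 1) ≤ S.card) :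
    ∃ e : List G, e.length = h ∧ e.Nodup ∧ (∀ x ∈ e, x ∈ S) ∧
      tWeakOrd t (l ++ e) := by
  classical
  clear hh
  induction h with
  | zero => exact ⟨[], by simpa using hl⟩
  | succ n ih =>
    obtain ⟨e, hlen, hnd, heS, he⟩ := ih (by omega)
    have hcard : t - 1 < (S \ e.toFinset).card := by
      have h₁ := Finset.le_card_sdiff e.toFinset S
      have h₂ := e.toFinset_card_le
      omega
    obtain ⟨x, hx, hxe⟩ := he.exists_append_singleton
      (fun y hy => hS0 y (Finset.mem_sdiff.mp hy).1) hcard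
    obtain ⟨hxS, hxe'⟩ := Finset.mem_sdiff.mp hx
    rw [List.mem_toFinset] at hxe'
    refine ⟨e ++ [x], by simp [hlen], ?_, ?_, by rwa [← List.append_assoc]⟩
    · exact hnd.append (List.nodup_singleton x) (by simpa using hxe')
    · intro y hy
      rcases List.mem_append.mp hy with hy | hy
      · exact heS y hy
      · rwa [List.mem_singleton.mp hy]
end

section
/- For every positive integer t there exists a constant K(t) such that the following holds for every group (G,+) (not necessarily abelian): if M is a finite multiset of size m of non-identity elements of G admitting a t-weak ordering (y_1, …, y_m), and S is a finite set of k ≥ K(t) non-identity elements of G, then there exists an ordering (y_{m+1}, …, y_{m+k}) of the elements of S such that (y_1, …, y_m, y_{m+1}, …, y_{m+k}) is a t-weak ordering of the multiset M ∪ S. -/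
section WeakOrdering

variable {G : Type*} [AddGroup G]

open Classical in
/-- A finite set containing every `u` for which appending `u` to `l` would create a
vanishing sum of at most `t` consecutive terms. -/
noncomputable def forbiddenNext (t : ℕ) (l : List G) : Finset G :=
  (Finset.range t).image fun j => -l.sum + (l.take (l.length - j)).sum

/-- No sum of at most `t` distinct elements of `T`, taken in any order, vanishes. -/
def ZeroSumFree (t : ℕ) (T : Finset G) : Prop :=
  ∀ w : List G, w.Nodup → w ≠ [] → w.length ≤ t → (∀ x ∈ w, x ∈ T) → w.sum ≠ 0

lemma ZeroSumFree.mono {t : ℕ} {T T' : Finset G} (h : ZeroSumFree t T) (hT : T' ⊆ T) :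
    ZeroSumFree t T' :=
  fun w h1 h2 h3 h4 => h w h1 h2 h3 fun x hx => hT (h4 x hx)

lemma card_forbiddenNext_le (t : ℕ) (l : List G) : (forbiddenNext t l).card ≤ t := by
  classical
  unfold forbiddenNext
  exact Finset.card_image_le.trans (by simp)

lemma tWeakOrd.append_singleton_s6 {t : ℕ} {l : List G} (hl : tWeakOrd t l) {u : G}
    (hu : u ∉ forbiddenNext t l) : tWeakOrd t (l ++ [u]) := by
  classical
  intro i j hij hj hjt heq
  have hj' : j ≤ l.length + 1 := by simpa using hj
  rcases Nat.lt_or_ge l.length j with h | h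
  · obtain rfl : j = l.length + 1 := by omega
    rw [List.take_append_of_le_length (by omega),
      List.take_of_length_le (l := l ++ [u]) (by simp), List.sum_append, List.sum_singleton] at heq
    refine hu (Finset.mem_image.2 ⟨l.length - i, Finset.mem_range.2 (by omega), ?_⟩)
    rw [show l.length - (l.length - i) = i by omega, heq, neg_add_cancel_left]
  · rw [List.take_append_of_le_length (by omega), List.take_append_of_le_length h] at heq
    exact hl i j hij h hjt heq

lemma mem_forbiddenNext_append_singleton {t : ℕ} {l : List G} {z r : G} (hr : r ≠ 0)
    (h : r ∈ forbiddenNext t (l ++ [z])) : ∃ f ∈ forbiddenNext t l, f - r = z := by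
  classical
  obtain ⟨j, hj, rfl⟩ := Finset.mem_image.1 h
  rw [Finset.mem_range] at hj
  rcases j with _ | j
  · exact absurd (by simp) hr
  · refine ⟨_, Finset.mem_image.2 ⟨j, Finset.mem_range.2 (by omega), rfl⟩, ?_⟩
    rw [List.length_append, List.length_singleton,
      show l.length + 1 - (j + 1) = l.length - j by omega,
      List.take_append_of_le_length (by omega), List.sum_append, List.sum_singleton]
    simp [sub_eq_add_neg, neg_add_rev, add_assoc]

lemma exists_append_singleton {t : ℕ} {l : List G} (hl : tWeakOrd t l) {U : Finset G}
    (hU : t < U.card) : ∃ u ∈ U, tWeakOrd t (l ++ [u]) := by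
  obtain ⟨u, hu, hu'⟩ := Finset.exists_mem_notMem_of_card_lt_card
    ((card_forbiddenNext_le t l).trans_lt hU)
  exact ⟨u, hu, hl.append_singleton_s6 hu'⟩

lemma exists_append_pair {t : ℕ} {l : List G} (hl : tWeakOrd t l) {T : Finset G}
    (hT : 2 * t < T.card) {r : G} (hr : r ≠ 0) :
    ∃ z ∈ T, tWeakOrd t (l ++ [z] ++ [r]) := by
  classical
  have hF := card_forbiddenNext_le t l
  have hcard : (forbiddenNext t l ∪ (forbiddenNext t l).image (· - r)).card < T.card := by
    have h1 := Finset.card_union_le (forbiddenNext t l) ((forbiddenNext t l).image (· - r))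
    have h2 := Finset.card_image_le (s := forbiddenNext t l) (f := (· - r))
    omega
  obtain ⟨z, hz, hz'⟩ := Finset.exists_mem_notMem_of_card_lt_card hcard
  rw [Finset.mem_union, not_or] at hz'
  refine ⟨z, hz, (hl.append_singleton_s6 hz'.1).append_singleton_s6 fun h => hz'.2 ?_⟩
  exact Finset.mem_image.2 (mem_forbiddenNext_append_singleton hr h)

lemma exists_append_of_length {t : ℕ} (n : ℕ) {l : List G} (hl : tWeakOrd t l)
    {T : Finset G} (hT : n + t ≤ T.card) :
    ∃ (e : List G) (T' : Finset G),
      e.length = n ∧ (e : Multiset G) + T'.val = T.val ∧ tWeakOrd t (l ++ e) := by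
  classical
  induction n generalizing l T with
  | zero => exact ⟨[], T, rfl, by simp, by simpa using hl⟩
  | succ n ih =>
    obtain ⟨u, hu, hlu⟩ := exists_append_singleton hl (U := T) (by omega)
    obtain ⟨e, T', he, heT, hle⟩ := ih hlu (T := T.erase u)
      (by rw [Finset.card_erase_of_mem hu]; omega)
    refine ⟨u :: e, T', by simp [he], ?_, by simpa using hle⟩
    rw [← Multiset.cons_coe, Multiset.cons_add, heT, Finset.erase_val]
    exact Multiset.cons_erase hu

lemma exists_append_zeroSumFree {t : ℕ} {l : List G} (hl : tWeakOrd t l) {T : Finset G}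
    (hT : ZeroSumFree t T) (hcard : 2 * t ≤ T.card) :
    ∃ e : List G, (e : Multiset G) = T.val ∧ tWeakOrd t (l ++ e) := by
  obtain ⟨e, T', he, heT, hle⟩ := exists_append_of_length t hl (T := T) (by omega)
  have hval : ((e ++ T'.toList : List G) : Multiset G) = T.val := by
    rw [← Multiset.coe_add, Finset.coe_toList, heT]
  refine ⟨e ++ T'.toList, hval, ?_⟩
  generalize hL : T'.toList = f at hval ⊢
  intro i j hij hj hjt heq
  rcases Nat.lt_or_ge (l ++ e).length j with h | h
  · rw [List.length_append] at h
    have hi : l.length ≤ i := by omega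
    have hj' : j ≤ l.length + (e ++ f).length := by simpa using hj
    have hnodup : (e ++ f).Nodup := by
      rw [← Multiset.coe_nodup, hval]; exact T.nodup
    obtain ⟨a, rfl⟩ := Nat.exists_eq_add_of_le hi
    obtain ⟨b, rfl⟩ := Nat.exists_eq_add_of_le (hi.trans hij.le)
    rw [List.take_length_add_append, List.take_length_add_append,
      List.sum_append, List.sum_append] at heq
    have heq := add_left_cancel heq
    have hsub : (((e ++ f).take b).drop a).Sublist (e ++ f) :=
      (List.drop_sublist _ _).trans (List.take_sublist _ _)
    have hlen : (((e ++ f).take b).drop a).length = b - a := by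
      rw [List.length_drop, List.length_take]; omega
    refine hT _ (hnodup.sublist hsub) ?_ (by omega) ?_ ?_
    · rw [← List.length_pos_iff]; omega
    · intro x hx
      rw [← Finset.mem_val, ← hval]
      exact hsub.subset hx
    · have h1 := congrArg List.sum (List.take_append_drop a ((e ++ f).take b))
      rw [List.sum_append, List.take_take, min_eq_left (by omega), heq] at h1
      simpa using h1
  · rw [← List.append_assoc, List.take_append_of_le_length (by omega),
      List.take_append_of_le_length h] at heq
    exact hle i j hij h hjt heq

lemma exists_append_of_zeroSumFree {t : ℕ} {l : List G} (hl : tWeakOrd t l)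
    {R T : Finset G} (hR : ∀ x ∈ R, x ≠ 0) (hT : ZeroSumFree t T)
    (hcard : 2 * t + 1 + min R.card t ≤ T.card) :
    ∃ e : List G, (e : Multiset G) = R.val + T.val ∧ tWeakOrd t (l ++ e) := by
  classical
  induction hn : R.card generalizing l R T with
  | zero =>
    obtain rfl := Finset.card_eq_zero.1 hn
    simpa using exists_append_zeroSumFree hl hT (by omega)
  | succ n ih =>
    rcases Nat.lt_or_ge t R.card with h | h
    · obtain ⟨u, hu, hlu⟩ := exists_append_singleton hl h
      have hc := Finset.card_erase_of_mem hu
      obtain ⟨e, he, hle⟩ := ih hlu (R := R.erase u)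
        (fun x hx => hR x (Finset.mem_of_mem_erase hx)) hT (by omega) (by omega)
      refine ⟨u :: e, ?_, by simpa using hle⟩
      rw [← Multiset.cons_coe, he, ← Multiset.cons_add, Finset.erase_val,
        Multiset.cons_erase hu]
    · obtain ⟨r, hr⟩ := Finset.card_pos.1 (by omega : 0 < R.card)
      obtain ⟨z, hz, hlz⟩ := exists_append_pair hl (T := T) (by omega) (hR r hr)
      have hc := Finset.card_erase_of_mem hr
      have hc' := Finset.card_erase_of_mem hz
      obtain ⟨e, he, hle⟩ := ih hlz (R := R.erase r)
        (fun x hx => hR x (Finset.mem_of_mem_erase hx))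
        (hT.mono (Finset.erase_subset z T)) (by omega) (by omega)
      refine ⟨z :: r :: e, ?_, by simpa using hle⟩
      rw [← Multiset.cons_coe, ← Multiset.cons_coe, he, ← Multiset.cons_add,
        Finset.erase_val, Multiset.cons_erase hr, ← Multiset.add_cons, Finset.erase_val,
        Multiset.cons_erase hz]

lemma exists_finset_list_sums (T : Finset G) (t : ℕ) :
    ∃ B : Finset G, B.card ≤ (T.card + 1) ^ t ∧
      ∀ w : List G, w.length ≤ t → (∀ x ∈ w, x ∈ T) → w.sum ∈ B := by
  classical
  induction t with
  | zero =>
    refine ⟨{0}, by simp, fun w hw _ => ?_⟩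
    rw [List.length_eq_zero_iff.1 (Nat.le_zero.1 hw)]
    simp
  | succ t ih =>
    obtain ⟨B, hB, hmem⟩ := ih
    refine ⟨Finset.image₂ (· + ·) (insert 0 T) B, ?_, ?_⟩
    · refine (Finset.card_image₂_le _ _ _).trans ?_
      rw [pow_succ']
      exact Nat.mul_le_mul (Finset.card_insert_le _ _) hB
    · rintro (_ | ⟨x, w⟩) hw hT
      · exact Finset.mem_image₂.2 ⟨0, by simp, 0, hmem [] (by simp) (by simp), by simp⟩
      · refine Finset.mem_image₂.2 ⟨x, ?_, w.sum, hmem w ?_ ?_, by simp⟩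
        · exact Finset.mem_insert_of_mem (hT x (by simp))
        · simpa using hw
        · exact fun y hy => hT y (List.mem_cons_of_mem _ hy)

end WeakOrdering

lemma exists_zeroSumFree_subset (t N : ℕ) :
    ∃ K : ℕ, ∀ (G : Type*) [AddGroup G], ∀ S : Finset G, K ≤ S.card →
      ∃ T ⊆ S, T.card = N ∧ ZeroSumFree t T := by
  classical
  induction N with
  | zero =>
    refine ⟨0, fun G _ S _ => ⟨∅, by simp, rfl, ?_⟩⟩
    intro w _ hw _ hmem
    obtain ⟨x, hx⟩ := List.exists_mem_of_ne_nil w hw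
    exact absurd (hmem x hx) (Finset.notMem_empty x)
  | succ N ih =>
    obtain ⟨K, hK⟩ := ih
    refine ⟨K + (N + (N + 1) ^ t * (N + 1) ^ t + 1), fun G _ S hS => ?_⟩
    obtain ⟨T, hTS, hTN, hT⟩ := hK G S (by omega)
    obtain ⟨B, hB, hmem⟩ := exists_finset_list_sums T t
    rw [hTN] at hB
    have hcard : (T ∪ Finset.image₂ (fun a b => -a - b) B B).card < S.card := by
      have h1 := Finset.card_union_le T (Finset.image₂ (fun a b => -a - b) B B)
      have h2 := (Finset.card_image₂_le (fun a b : G => -a - b) B B).trans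
        (Nat.mul_le_mul hB hB)
      omega
    obtain ⟨x, hx, hx'⟩ := Finset.exists_mem_notMem_of_card_lt_card hcard
    rw [Finset.mem_union, not_or] at hx'
    refine ⟨insert x T, Finset.insert_subset hx hTS, ?_, ?_⟩
    · rw [Finset.card_insert_of_notMem hx'.1, hTN]
    · intro w hnodup hne hlen hw hsum
      by_cases hxw : x ∈ w
      · obtain ⟨a, b, rfl⟩ := List.append_of_mem hxw
        have hnd := List.nodup_middle.1 hnodup
        rw [List.nodup_cons, List.mem_append, not_or] at hnd
        rw [List.length_append, List.length_cons] at hlen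
        refine hx'.2 (Finset.mem_image₂.2
          ⟨a.sum, hmem a (by omega) fun y hy => ?_,
            b.sum, hmem b (by omega) fun y hy => ?_, ?_⟩)
        · refine Finset.mem_of_mem_insert_of_ne (hw y (by simp [hy])) ?_
          rintro rfl
          exact hnd.1.1 hy
        · refine Finset.mem_of_mem_insert_of_ne (hw y (by simp [hy])) ?_
          rintro rfl
          exact hnd.1.2 hy
        · rw [List.sum_append, List.sum_cons, ← add_assoc] at hsum
          rw [neg_eq_of_add_eq_zero_right (a := a.sum) (b := x + b.sum)
            (by rw [← add_assoc]; exact hsum), add_sub_cancel_right]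
      · refine hT w hnodup hne hlen (fun y hy => ?_) hsum
        refine Finset.mem_of_mem_insert_of_ne (hw y hy) ?_
        rintro rfl
        exact hxw hy

/-- For every positive integer `t` there is `K` such that: in any group `G`, any
`t`-weak ordering `l` of a multiset of non-identity elements can be extended by an
ordering of any finite set `S` of at least `K` non-identity elements, yielding a
`t`-weak ordering of `M ∪ S`. -/
theorem extend_weak_ordering_by_set (t : ℕ) (ht : 0 < t) :
    ∃ K : ℕ, ∀ (G : Type*) [AddGroup G],
      ∀ l : List G, (∀ x ∈ l, x ≠ (0 : G)) → tWeakOrd t l →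
      ∀ S : Finset G, (∀ x ∈ S, x ≠ (0 : G)) → K ≤ S.card →
        ∃ e : List G, (↑e : Multiset G) = S.val ∧ tWeakOrd t (l ++ e) := by
  classical
  obtain ⟨K, hK⟩ := exists_zeroSumFree_subset t (3 * t + 1)
  refine ⟨K, fun G _ l _ hl S hS hcard => ?_⟩
  obtain ⟨T, hTS, hTcard, hT⟩ := hK G S hcard
  obtain ⟨e, he, hle⟩ := exists_append_of_zeroSumFree hl (R := S \ T)
    (fun x hx => hS x (Finset.mem_sdiff.1 hx).1) hT (by omega)
  refine ⟨e, ?_, hle⟩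
  rw [he, Finset.sdiff_val]
  exact tsub_add_cancel_of_le (Finset.val_le_iff.2 hTS)
end

section
/- For all positive integers t and ℓ there exists a constant k_{t,ℓ} such that the following holds for every group (G,+) (not necessarily abelian): every subset S of G ∖ {0} of size k > k_{t,ℓ} contains a subset T of size at least ℓ such that no nonempty sub-tuple of distinct elements of T of length at most t has sum equal to 0; that is, for every g with 1 ≤ g ≤ t and every sequence (x_1, …, x_g) of pairwise distinct elements of T, one has x_1 + x_2 + ⋯ + x_g ≠ 0. -/
/-- If `S` is large in terms of `n`, then outside any `T` of size `n` it has an element that is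
not of the form `-s.sum + -u.sum` with `s`, `u` duplicate-free lists of elements of `T`. -/
theorem exists_mem_forall_ne_neg_sum_add_neg_sum {G : Type*} [AddGroup G] {n : ℕ}
    (S T : Finset G) (hT : T.card = n)
    (hS : n + Fintype.card ({l : List (Fin n) // l.Nodup} × {l : List (Fin n) // l.Nodup})
      < S.card) :
    ∃ a ∈ S, a ∉ T ∧ ∀ s u : List G, s.Nodup → u.Nodup → (∀ b ∈ s, b ∈ T) →
      (∀ b ∈ u, b ∈ T) → a ≠ -s.sum + -u.sum := by
  classical
  let f : Fin n → G := fun i => (T.equivFinOfCardEq hT).symm i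
  have lift_list : ∀ s : List G, s.Nodup → (∀ b ∈ s, b ∈ T) →
      ∃ l : {l : List (Fin n) // l.Nodup}, l.1.map f = s := by
    intro s hs hsT
    have hmem : s ∈ Set.range (List.map f) := by
      rw [Set.range_list_map]
      intro b hb
      exact ⟨T.equivFinOfCardEq hT ⟨b, hsT b hb⟩, by simp [f]⟩
    obtain ⟨l, rfl⟩ := hmem
    exact ⟨⟨l, hs.of_map f⟩, rfl⟩
  let F : Finset G := Finset.univ.image
    fun p : {l : List (Fin n) // l.Nodup} × {l : List (Fin n) // l.Nodup} =>
      -(p.1.1.map f).sum + -(p.2.1.map f).sum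
  have hF : (T ∪ F).card < S.card :=
    ((Finset.card_union_le _ _).trans
      (Nat.add_le_add hT.le Finset.card_image_le)).trans_lt hS
  obtain ⟨a, haS, ha⟩ := Finset.exists_mem_notMem_of_card_lt_card hF
  rw [Finset.mem_union, not_or] at ha
  refine ⟨a, haS, ha.1, fun s u hs hu hsT huT h => ha.2 ?_⟩
  obtain ⟨l, rfl⟩ := lift_list s hs hsT
  obtain ⟨m, rfl⟩ := lift_list u hu huT
  exact Finset.mem_image.2 ⟨(l, m), Finset.mem_univ _, h.symm⟩

/-- A sufficiently large set `S` contains a subset of size `n` in which no nonempty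
duplicate-free list, of any length, has sum zero. -/
theorem exists_subset_card_eq_forall_nodup_sum_ne_zero (n : ℕ) :
    ∃ k : ℕ, ∀ (G : Type*) [AddGroup G] (S : Finset G),
      k < S.card →
      ∃ T ⊆ S, T.card = n ∧
        ∀ x : List G, x.Nodup → (∀ a ∈ x, a ∈ T) → x ≠ [] → x.sum ≠ 0 := by
  induction n with
  | zero =>
    refine ⟨0, fun G _ S _ => ⟨∅, by simp, rfl, fun x _ hx hne => ?_⟩⟩
    exact absurd (List.eq_nil_iff_forall_not_mem.2 fun a ha => by simpa using hx a ha) hne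
  | succ n ih =>
    classical
    obtain ⟨k, hk⟩ := ih
    refine ⟨max k (n +
      Fintype.card ({l : List (Fin n) // l.Nodup} × {l : List (Fin n) // l.Nodup})),
      fun G _ S hcard => ?_⟩
    obtain ⟨T, hTS, hT, hsum⟩ := hk G S ((le_max_left _ _).trans_lt hcard)
    obtain ⟨a, haS, haT, ha⟩ :=
      exists_mem_forall_ne_neg_sum_add_neg_sum S T hT ((le_max_right _ _).trans_lt hcard)
    refine ⟨insert a T, Finset.insert_subset haS hTS,
      by rw [Finset.card_insert_of_notMem haT, hT], fun x hx hxT hne h0 => ?_⟩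
    by_cases hax : a ∈ x
    · obtain ⟨s, u, rfl⟩ := List.append_of_mem hax
      rw [List.nodup_middle, List.nodup_cons, List.mem_append, not_or] at hx
      obtain ⟨⟨has, hau⟩, hsu⟩ := hx
      refine ha s u hsu.of_append_left hsu.of_append_right
        (fun b hb => Finset.mem_of_mem_insert_of_ne (hxT b (by simp [hb]))
          (ne_of_mem_of_not_mem hb has))
        (fun b hb => Finset.mem_of_mem_insert_of_ne (hxT b (by simp [hb]))
          (ne_of_mem_of_not_mem hb hau)) ?_
      rw [List.sum_append, List.sum_cons] at h0
      rw [eq_add_neg_iff_add_eq]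
      exact eq_neg_of_add_eq_zero_right h0
    · exact hsum x hx (fun b hb => Finset.mem_of_mem_insert_of_ne (hxT b hb)
        (ne_of_mem_of_not_mem hb hax)) hne h0

/-- For all positive integers `t`, `ℓ` there is a constant `k` such that: in any group
`G`, every subset `S` of `G \ {0}` with more than `k` elements contains a subset `T`
of size at least `ℓ` admitting no zero-sum subsets (in any order) of size `g ≤ t`. -/
theorem exists_large_zero_sum_free_subset (t ℓ : ℕ) (ht : 0 < t) (hℓ : 0 < ℓ) :
    ∃ k : ℕ, ∀ (G : Type*) [AddGroup G] (S : Finset G),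
      (∀ x ∈ S, x ≠ (0 : G)) → k < S.card →
      ∃ T ⊆ S, ℓ ≤ T.card ∧
        ∀ x : List G, x.Nodup → (∀ a ∈ x, a ∈ T) →
          1 ≤ x.length → x.length ≤ t → x.sum ≠ 0 := by
  obtain ⟨k, hk⟩ := exists_subset_card_eq_forall_nodup_sum_ne_zero ℓ
  refine ⟨k, fun G _ S _ hcard => ?_⟩
  obtain ⟨T, hTS, hT, hsum⟩ := hk G S hcard
  exact ⟨T, hTS, hT.ge, fun x hx hxT hlen _ =>
    hsum x hx hxT (List.ne_nil_of_length_pos hlen)⟩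
end

section
/- Let v and m be positive integers and let S be a nonempty subset of Z_v with |S|·(m+1) ≤ v. Then there exists w ∈ S such that w + j ∉ S for all integers j with 1 ≤ j ≤ m, where w + j denotes addition in Z_v of w and the residue class of j. -/
/-- If every element of a nonempty `S` is followed by another element of `S` within distance `m`,
then the translates of `S` by `0, …, m - 1` cover `ZMod v`. -/
theorem ZMod.exists_add_natCast_eq_of_forall_exists_add_mem {v m : ℕ} [NeZero v] (hm : 0 < m)
    {S : Set (ZMod v)} (hS : S.Nonempty)
    (h : ∀ w ∈ S, ∃ j : ℕ, 1 ≤ j ∧ j ≤ m ∧ w + (j : ZMod v) ∈ S) (x : ZMod v) :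
    ∃ w ∈ S, ∃ i < m, w + (i : ZMod v) = x := by
  obtain ⟨w₀, hw₀⟩ := hS
  have key : ∀ n : ℕ, ∃ w ∈ S, ∃ i < m, w + (i : ZMod v) = w₀ + (n : ZMod v) := by
    intro n
    induction n with
    | zero => exact ⟨w₀, hw₀, 0, hm, rfl⟩
    | succ n ih =>
      obtain ⟨w, hw, i, hi, hwi⟩ := ih
      obtain hlt | heq : i + 1 < m ∨ i + 1 = m := by omega
      · exact ⟨w, hw, i + 1, hlt, by push_cast; rw [← add_assoc, ← add_assoc, hwi]⟩
      · obtain ⟨j, hj₁, hjm, hj⟩ := h w hw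
        refine ⟨_, hj, m - j, by omega, ?_⟩
        rw [add_assoc, ← Nat.cast_add, Nat.add_sub_cancel' hjm, ← heq]
        push_cast
        rw [← add_assoc, ← add_assoc, hwi]
  simpa using key (x - w₀).val

/-- If `S` is a nonempty subset of `ZMod v` with `|S|·(m+1) ≤ v`, then some `w ∈ S`
is followed by a gap: `w + j ∉ S` for all integers `1 ≤ j ≤ m`. -/
theorem exists_gap_after_element (v m : ℕ) (hv : 0 < v) (hm : 0 < m)
    (S : Finset (ZMod v)) (hS : S.Nonempty)
    (hcard : S.card * (m + 1) ≤ v) :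
    ∃ w ∈ S, ∀ j : ℕ, 1 ≤ j → j ≤ m → w + ((j : ℕ) : ZMod v) ∉ S := by
  by_contra! h
  have : NeZero v := ⟨hv.ne'⟩
  have hsurj : Finset.univ ⊆ (S ×ˢ Finset.range m).image fun p => p.1 + (p.2 : ZMod v) := by
    intro x _
    obtain ⟨w, hw, i, hi, hx⟩ :=
      ZMod.exists_add_natCast_eq_of_forall_exists_add_mem hm (S := (S : Set (ZMod v))) hS h x
    exact Finset.mem_image.2
      ⟨(w, i), Finset.mem_product.2 ⟨hw, Finset.mem_range.2 hi⟩, hx⟩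
  have hle := (Finset.card_le_card hsurj).trans Finset.card_image_le
  rw [Finset.card_univ, ZMod.card, Finset.card_product, Finset.card_range] at hle
  have hpos := hS.card_pos
  rw [mul_add_one] at hcard
  omega
end

section
/- Let (G,+) be a group (not necessarily abelian), let t be a positive integer, and let a_1, a_2 be elements of G, each of order greater than t, such that the cyclic subgroups generated by a_1 and a_2 intersect trivially: ⟨a_1⟩ ∩ ⟨a_2⟩ = {0}. Let λ_1 ≥ 2t and λ_2 ≥ 1. Then the sequence consisting of λ_1 − t copies of a_1, followed by λ_2 copies of a_2, followed by t copies of a_1, is a t-weak sequencing of the multiset [a_1^{λ_1}, a_2^{λ_2}]. -/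
/-- Two elements generating disjoint cyclic subgroups, none of whose first `t` positive multiples
vanish, admit no short relation of the form `d • a + e • b + f • a = 0`. -/
theorem nsmul_add_nsmul_add_nsmul_ne_zero {G : Type*} [AddGroup G] {t : ℕ} {a b : G}
    (ha : ∀ i : ℕ, 1 ≤ i → i ≤ t → i • a ≠ 0) (hb : ∀ i : ℕ, 1 ≤ i → i ≤ t → i • b ≠ 0)
    (hdisj : AddSubgroup.zmultiples a ⊓ AddSubgroup.zmultiples b = ⊥) {d e f : ℕ}
    (hpos : 1 ≤ d + e + f) (hle : d + e + f ≤ t) : d • a + e • b + f • a ≠ 0 := by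
  intro h
  have h' : e • b = -(d • a) - f • a := by
    rw [sub_eq_add_neg, eq_neg_add_iff_add_eq, ← add_eq_zero_iff_eq_neg, h]
  have hmem : e • b ∈ AddSubgroup.zmultiples a ⊓ AddSubgroup.zmultiples b := by
    refine AddSubgroup.mem_inf.mpr ⟨?_, AddSubgroup.nsmul_mem_zmultiples b e⟩
    rw [h']
    exact sub_mem (neg_mem (AddSubgroup.nsmul_mem_zmultiples a d))
      (AddSubgroup.nsmul_mem_zmultiples a f)
  have he : e • b = 0 := by rwa [hdisj, AddSubgroup.mem_bot] at hmem
  have hdf : (d + f) • a = 0 := by rwa [he, add_zero, ← add_nsmul] at h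
  have hdf0 : d + f = 0 := by
    by_contra hne
    exact ha (d + f) (by omega) (by omega) hdf
  exact hb e (by omega) (by omega) he

/-- The partial sums of three consecutive constant blocks. -/
theorem sum_take_replicate_append_replicate_append_replicate {G : Type*} [AddMonoid G]
    (p q r i : ℕ) (a b c : G) :
    ((List.replicate p a ++ List.replicate q b ++ List.replicate r c).take i).sum =
      min i p • a + min (i - p) q • b + min (i - (p + q)) r • c := by
  simp [List.take_append, List.take_replicate, List.sum_replicate, add_assoc, Nat.sub_sub]

/-- If `a₁, a₂ ∈ G` each have order greater than `t` (i.e. `i • a ≠ 0` for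
`1 ≤ i ≤ t`) and the cyclic subgroups they generate intersect trivially, then for
`λ₁ ≥ 2t` and `λ₂ ≥ 1` the sequence consisting of `λ₁ - t` copies of `a₁`, then `λ₂`
copies of `a₂`, then `t` copies of `a₁`, is a `t`-weak sequencing of
`[a₁^{λ₁}, a₂^{λ₂}]`. -/
theorem replicate_sequencing_of_disjoint_cyclic {G : Type*} [AddGroup G]
    (t : ℕ) (ht : 0 < t) (a₁ a₂ : G)
    (ha₁ : ∀ i : ℕ, 1 ≤ i → i ≤ t → i • a₁ ≠ 0)
    (ha₂ : ∀ i : ℕ, 1 ≤ i → i ≤ t → i • a₂ ≠ 0)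
    (hdisj : AddSubgroup.zmultiples a₁ ⊓ AddSubgroup.zmultiples a₂ = ⊥)
    (lam₁ lam₂ : ℕ) (h₁ : 2 * t ≤ lam₁) (h₂ : 1 ≤ lam₂) :
    (↑(List.replicate (lam₁ - t) a₁ ++ List.replicate lam₂ a₂ ++
        List.replicate t a₁) : Multiset G) =
      Multiset.replicate lam₁ a₁ + Multiset.replicate lam₂ a₂ ∧
    tWeakOrd t (List.replicate (lam₁ - t) a₁ ++ List.replicate lam₂ a₂ ++
      List.replicate t a₁) := by
  refine ⟨?_, ?_⟩
  · have hsum : lam₁ = lam₁ - t + t := by omega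
    rw [← Multiset.coe_add, ← Multiset.coe_add]
    simp only [Multiset.coe_replicate]
    conv_rhs => rw [hsum, Multiset.replicate_add]
    rw [add_right_comm]
  · intro i j hij hj hjt h
    simp only [List.length_append, List.length_replicate] at hj
    rw [sum_take_replicate_append_replicate_append_replicate,
      sum_take_replicate_append_replicate_append_replicate] at h
    obtain hi | hi := le_total i (lam₁ - t)
    · obtain ⟨d, hd⟩ : ∃ d, min j (lam₁ - t) = i + d := ⟨min j (lam₁ - t) - i, by omega⟩
      rw [min_eq_left hi, show i - (lam₁ - t) = 0 by omega,
        show i - (lam₁ - t + lam₂) = 0 by omega, hd, add_nsmul] at h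
      simp only [zero_min, zero_nsmul, add_zero, add_assoc, left_eq_add] at h
      rw [← add_assoc] at h
      exact nsmul_add_nsmul_add_nsmul_ne_zero ha₁ ha₂ hdisj (by omega) (by omega) h
    · obtain ⟨e, he⟩ : ∃ e, min (j - (lam₁ - t)) lam₂ = min (i - (lam₁ - t)) lam₂ + e :=
        ⟨min (j - (lam₁ - t)) lam₂ - min (i - (lam₁ - t)) lam₂, by omega⟩
      obtain ⟨f, hf⟩ : ∃ f, min (j - (lam₁ - t + lam₂)) t =
          f + min (i - (lam₁ - t + lam₂)) t :=
        ⟨min (j - (lam₁ - t + lam₂)) t - min (i - (lam₁ - t + lam₂)) t, by omega⟩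
      rw [min_eq_right hi, min_eq_right (hi.trans hij.le), he, hf, add_nsmul, add_nsmul] at h
      simp only [add_assoc, add_right_inj] at h
      rw [← add_assoc, right_eq_add] at h
      refine nsmul_add_nsmul_add_nsmul_ne_zero (d := 0) (e := e) (f := f) ha₁ ha₂ hdisj
        (by omega) (by omega) ?_
      rwa [zero_nsmul, zero_add]
end

section
/- Let (G,+) be a group (not necessarily abelian), let t be a positive integer, and let a_1 ∈ G have order greater than t. Let U = (u_0, …, u_m) and V = (v_0, …, v_n) be walks in G with u_0 = 0, v_0 = 0, and m, n ≥ t, such that: (i) −u_{i−1} + u_i = a_1 for all i ∈ {m−t+1, …, m}; (ii) −v_{i−1} + v_i = a_1 for all i ∈ {1, …, t}; (iii) u_i ≠ u_j whenever 1 ≤ |i−j| ≤ t, and v_i ≠ v_j whenever 1 ≤ |i−j| ≤ t. Define the concatenated walk W = (w_0, …, w_{m+n}) by w_i = u_i for 0 ≤ i ≤ m and w_i = u_m + v_{i−m} for m < i ≤ m+n. Then w_i ≠ w_j whenever 1 ≤ |i−j| ≤ t. -/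
/-- A walk whose `d` steps after position `p` all equal `a` advances by `d • a`. -/
theorem walk_add_nsmul_of_const_steps {G : Type*} [AddGroup G] (w : ℕ → G) (a : G) (p d : ℕ)
    (h : ∀ i : ℕ, p + 1 ≤ i → i ≤ p + d → -(w (i - 1)) + w i = a) :
    w (p + d) = w p + d • a := by
  induction d with
  | zero => simp
  | succ d ih =>
    have hstep := h (p + d + 1) (by omega) (by omega)
    rw [Nat.add_sub_cancel, neg_add_eq_iff_eq_add] at hstep
    rw [← add_assoc, hstep, ih fun i h₁ h₂ => h i h₁ (by omega), succ_nsmul, add_assoc]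

/-- Gluing two `t`-locally-injective walks whose junction steps all equal an element
`a₁` of order greater than `t` (i.e. `i • a₁ ≠ 0` for `1 ≤ i ≤ t`): the last `t`
steps of `U` and the first `t` steps of `V` are `a₁`, both walks start at `0`, and
each walk has pairwise distinct vertices at distance at most `t`. Then the
concatenated walk `W` (with `w_i = u_i` for `i ≤ m` and `w_i = u_m + v_{i-m}` for
`m < i ≤ m+n`) also has `w_i ≠ w_j` whenever `1 ≤ |i - j| ≤ t`. -/
theorem glued_walk_locally_injective {G : Type*} [AddGroup G]
    (t : ℕ) (ht : 0 < t) (a₁ : G)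
    (ha₁ : ∀ i : ℕ, 1 ≤ i → i ≤ t → i • a₁ ≠ 0)
    (m n : ℕ) (hm : t ≤ m) (hn : t ≤ n)
    (u v : ℕ → G) (hu0 : u 0 = 0) (hv0 : v 0 = 0)
    (hu_end : ∀ i : ℕ, m - t + 1 ≤ i → i ≤ m → -(u (i - 1)) + u i = a₁)
    (hv_start : ∀ i : ℕ, 1 ≤ i → i ≤ t → -(v (i - 1)) + v i = a₁)
    (hu : ∀ i j : ℕ, i < j → j ≤ m → j - i ≤ t → u i ≠ u j)
    (hv : ∀ i j : ℕ, i < j → j ≤ n → j - i ≤ t → v i ≠ v j) :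
    ∀ i j : ℕ, i < j → j ≤ m + n → j - i ≤ t →
      (if i ≤ m then u i else u m + v (i - m)) ≠
      (if j ≤ m then u j else u m + v (j - m)) := by
  intro i j hij hj hd
  split_ifs with him hjm hjm
  · exact hu i j hij hjm hd
  · have hum := walk_add_nsmul_of_const_steps u a₁ i (m - i)
      fun k h₁ h₂ => hu_end k (by omega) (by omega)
    have hvj := walk_add_nsmul_of_const_steps v a₁ 0 (j - m)
      fun k h₁ h₂ => hv_start k (by omega) (by omega)
    rw [Nat.add_sub_cancel' him] at hum
    rw [Nat.zero_add, hv0, zero_add] at hvj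
    rw [hum, hvj, add_assoc, ← add_nsmul, ne_comm, Ne, add_eq_left]
    exact ha₁ _ (by omega) (by omega)
  · omega
  · rw [Ne, add_right_inj]
    exact hv _ _ (by omega) (by omega) (by omega)
end
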